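/- There exists a universal constant C > 0 such that the following holds. Let X be an isotropic log-concave random vector in ℝⁿ, let 0 = l_0 < l_1 < l_2 < … < l_k ≤ n be integers, and let t_1,…,t_k ≥ 0 satisfy t_r ≥ C·log(C²·n / ∑_{j=1}^k t_j²(l_j − l_{j−1})) for every 1 ≤ r ≤ k. Then P(X*_{l_1} ≥ t_1, …, X*_{l_k} ≥ t_k) ≤ exp(−σ_X^{−1}((1/C)·√(∑_{j=1}^k t_j²(l_j − l_{j−1})))). -/

import Mathlib

open MeasureTheory ProbabilityTheory Real
open scoped Pointwise ENNReal RealInnerProductSpace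

noncomputable section

variable {Ω : Type*} [MeasurableSpace Ω]

/-- A random vector `X` in `ℝⁿ` is log-concave: for all nonempty compact sets `K, L` and
`a ∈ [0,1]`, `P(X ∈ aK + (1-a)L) ≥ P(X ∈ K)^a * P(X ∈ L)^(1-a)`. -/
def IsLogConcave {n : ℕ} (μ : Measure Ω) (X : Ω → EuclideanSpace ℝ (Fin n)) : Prop :=
  ∀ K L : Set (EuclideanSpace ℝ (Fin n)), K.Nonempty → L.Nonempty →
    IsCompact K → IsCompact L → ∀ a : ℝ, 0 ≤ a → a ≤ 1 →
      (μ (X ⁻¹' K)).toReal ^ a * (μ (X ⁻¹' L)).toReal ^ (1 - a) ≤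
        (μ (X ⁻¹' (a • K + (1 - a) • L))).toReal

/-- `X` is isotropic: centered with identity covariance matrix. -/
def IsIsotropic {n : ℕ} (μ : Measure Ω) (X : Ω → EuclideanSpace ℝ (Fin n)) : Prop :=
  (∀ i, ∫ ω, X ω i ∂μ = 0) ∧
  ∀ i j, ∫ ω, X ω i * X ω j ∂μ = if i = j then (1 : ℝ) else 0

/-- `σ_X(p) = sup_{|t| = 1} (E|⟨t,X⟩|^p)^(1/p)`. -/
def sigmaX {n : ℕ} (μ : Measure Ω) (X : Ω → EuclideanSpace ℝ (Fin n)) (p : ℝ) : ℝ :=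
  ⨆ t : {t : EuclideanSpace ℝ (Fin n) // ‖t‖ = 1},
    (∫ ω, |⟪t.1, X ω⟫| ^ p ∂μ) ^ (1 / p)

/-- Generalized inverse of `σ_X`. -/
def sigmaXInv {n : ℕ} (μ : Measure Ω) (X : Ω → EuclideanSpace ℝ (Fin n)) (s : ℝ) : ℝ :=
  sSup {p : ℝ | 1 ≤ p ∧ sigmaX μ X p ≤ s}

/-- The `m`-th order statistic `X*_m` of `(|x 1|, …, |x n|)`: the `m`-th largest among the
absolute values of the coordinates, expressed as `max_{|I| = m} min_{i ∈ I} |x i|`. -/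
def orderStat {n : ℕ} (x : Fin n → ℝ) (m : ℕ) : ℝ :=
  ⨆ I : {I : Finset (Fin n) // I.card = m}, ⨅ i : I.1, |x i|

section Gaussian

variable {E : Type*} [NormedAddCommGroup E] [InnerProductSpace ℝ E] [FiniteDimensional ℝ E]
  [MeasurableSpace E] [BorelSpace E]

lemma stdGaussian_map_inner (x : E) :
    (stdGaussian E).map (fun y => ⟪y, x⟫) = gaussianReal 0 (‖x‖ ^ 2).toNNReal := by
  have h := IsGaussian.map_eq_gaussianReal (μ := stdGaussian E) (innerSL ℝ x)
  rw [variance_dual_stdGaussian, integral_strongDual_stdGaussian, innerSL_apply_norm] at h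
  rw [← h]
  congr 1
  ext y
  simp [real_inner_comm]

lemma mgf_stdGaussian_inner (x : E) (t : ℝ) :
    mgf (fun y => ⟪y, x⟫) (stdGaussian E) t = rexp (‖x‖ ^ 2 * t ^ 2 / 2) := by
  rw [mgf_gaussianReal (stdGaussian_map_inner x)]
  rw [Real.coe_toNNReal _ (by positivity)]
  simp

lemma integrable_exp_stdGaussian_inner (x : E) (t : ℝ) :
    Integrable (fun y => rexp (t * ⟪y, x⟫)) (stdGaussian E) := by
  have h := integrable_exp_mul_gaussianReal (μ := 0) (v := (‖x‖ ^ 2).toNNReal) t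
  rw [← stdGaussian_map_inner x] at h
  exact h.comp_measurable (by fun_prop)

lemma stdGaussian_inner_tail (x : E) {r u : ℝ} (hr : 0 < r) (hx : ‖x‖ ≤ r) (hu : 0 ≤ u) :
    (stdGaussian E).real {y | u ≤ ⟪y, x⟫} ≤ rexp (-(u ^ 2 / (2 * r ^ 2))) := by
  have ht : 0 ≤ u / r ^ 2 := by positivity
  refine (measure_ge_le_exp_mul_mgf u ht (integrable_exp_stdGaussian_inner x _)).trans ?_
  rw [mgf_stdGaussian_inner, ← exp_add]
  apply exp_le_exp.2
  have h1 : ‖x‖ ^ 2 * (u / r ^ 2) ^ 2 / 2 ≤ r ^ 2 * (u / r ^ 2) ^ 2 / 2 := by gcongr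
  have h2 : r ^ 2 * (u / r ^ 2) ^ 2 / 2 = u ^ 2 / (2 * r ^ 2) := by field_simp
  have h3 : -(u / r ^ 2) * u = - (2 * (u ^ 2 / (2 * r ^ 2))) := by field_simp
  linarith

lemma exp_neg_le_gaussianReal {m : ℕ} (hm : 1 ≤ m) :
    rexp (-(3 * m)) ≤ (gaussianReal 0 1).real (Set.Ici (√m)) := by
  have hm' : (1 : ℝ) ≤ m := by exact_mod_cast hm
  have hs : √(m : ℝ) * √m = m := Real.mul_self_sqrt (by positivity)
  have hs1 : 1 ≤ √(m : ℝ) := Real.one_le_sqrt.2 hm'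
  have hpi : √(2 * π) ≤ rexp 1 := by
    have h1 : (2.7 : ℝ) ≤ rexp 1 := by have := Real.exp_one_gt_d9; linarith
    refine le_trans ?_ h1
    rw [Real.sqrt_le_left (by norm_num)]
    have := Real.pi_lt_d2
    norm_num; linarith
  have key : rexp (-(3 * m)) ≤ ∫ x in Set.Icc (√(m : ℝ)) (√m + 1), gaussianPDFReal 0 1 x := by
    have hle : ∀ x ∈ Set.Icc (√(m : ℝ)) (√m + 1), rexp (-(3 * m)) ≤ gaussianPDFReal 0 1 x := by
      intro x hx
      simp only [gaussianPDFReal, NNReal.coe_one, mul_one, sub_zero]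
      have h1 : rexp (-1) ≤ (√(2 * π))⁻¹ := by
        rw [exp_neg]
        exact inv_anti₀ (by positivity) hpi
      have h2 : rexp (-(2 * m)) ≤ rexp (-x ^ 2 / 2) := by
        apply exp_le_exp.2
        have : x ^ 2 ≤ (√(m : ℝ) + 1) ^ 2 := by
          have := hx.1
          have := hx.2
          gcongr
          linarith
        nlinarith
      calc rexp (-(3 * m)) ≤ rexp (-1) * rexp (-(2 * m)) := by
            rw [← exp_add]; apply exp_le_exp.2; linarith
        _ ≤ _ := by gcongr
    calc rexp (-(3 * m)) = ∫ x in Set.Icc (√(m : ℝ)) (√m + 1), rexp (-(3 * m)) := by simp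
      _ ≤ _ := setIntegral_mono_on (by simp) (integrable_gaussianPDFReal 0 1).integrableOn
          measurableSet_Icc hle
  rw [measureReal_def, gaussianReal_apply_eq_integral _ one_ne_zero, ENNReal.toReal_ofReal
    (integral_nonneg fun x => gaussianPDFReal_nonneg _ _ _)]
  refine key.trans (setIntegral_mono_set (integrable_gaussianPDFReal 0 1).integrableOn
    (ae_of_all _ fun x => gaussianPDFReal_nonneg _ _ _) ?_)
  exact LE.le.eventuallyLE Set.Icc_subset_Ici_self

lemma exp_neg_le_stdGaussian_inner (x : E) {r : ℝ} {m : ℕ} (hm : 1 ≤ m) (hr : 0 < r)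
    (hx : r ≤ ‖x‖) : rexp (-(3 * m)) ≤ (stdGaussian E).real {y | √m * r ≤ ⟪y, x⟫} := by
  have hx0 : 0 < ‖x‖ := hr.trans_le hx
  have h : (gaussianReal 0 1).map (‖x‖ * ·) = (stdGaussian E).map (fun y => ⟪y, x⟫) := by
    rw [stdGaussian_map_inner, gaussianReal_map_const_mul]
    congr 1
    · simp
    · ext; simp
  have h2 : (stdGaussian E).real {y | √m * ‖x‖ ≤ ⟪y, x⟫}
      = (gaussianReal 0 1).real (Set.Ici (√m)) := by
    have : (gaussianReal 0 1).real (Set.Ici (√m))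
        = ((gaussianReal 0 1).map (‖x‖ * ·)).real (Set.Ici (√m * ‖x‖)) := by
      rw [map_measureReal_apply (by fun_prop) measurableSet_Ici]
      congr 1
      ext z
      simp only [Set.mem_Ici, Set.mem_preimage]
      rw [mul_comm, mul_le_mul_iff_right₀ hx0]
    rw [this, h, map_measureReal_apply (by fun_prop) measurableSet_Ici]
    rfl
  refine (exp_neg_le_gaussianReal hm).trans (h2.symm.le.trans ?_)
  refine measureReal_mono fun y (hy : √m * ‖x‖ ≤ ⟪y, x⟫) => ?_
  exact (mul_le_mul_of_nonneg_left hx (by positivity)).trans hy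

lemma stdGaussian_inner_moment (x : E) {r : ℝ} {k : ℕ} (hk : 1 ≤ k) (hr : 0 < r)
    (hx : ‖x‖ ≤ r) :
    ∫⁻ y, ENNReal.ofReal (⟪y, x⟫ ^ (2 * k)) ∂(stdGaussian E) ≤
      ENNReal.ofReal ((12 * k * r ^ 2) ^ k) := by
  have hk' : (1 : ℝ) ≤ k := by exact_mod_cast hk
  set t : ℝ := √(2 * k) / r with ht
  have ht0 : 0 < t := by positivity
  have ht2 : t ^ 2 = 2 * k / r ^ 2 := by
    rw [ht, div_pow, Real.sq_sqrt (by positivity)]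
  have hpt : ∀ z : ℝ, z ^ (2 * k) ≤
      ((2 * k).factorial / t ^ (2 * k)) * (rexp (t * z) + rexp (-t * z)) := by
    intro z
    have h := Real.pow_div_factorial_le_exp (|t * z|) (abs_nonneg _) (2 * k)
    rw [Even.pow_abs (even_two_mul k)] at h
    have h' : rexp |t * z| ≤ rexp (t * z) + rexp (-t * z) := by
      rcases abs_cases (t * z) with ⟨h, -⟩ | ⟨h, -⟩
      · rw [h]; linarith [exp_pos (-t * z)]
      · rw [h, ← neg_mul]; linarith [exp_pos (t * z)]
    have h3 := h.trans h'
    rw [div_le_iff₀ (by positivity), mul_pow] at h3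
    rw [div_mul_eq_mul_div, le_div_iff₀ (by positivity)]
    linarith
  have hint : Integrable (fun y => ((2 * k).factorial / t ^ (2 * k)) *
      (rexp (t * ⟪y, x⟫) + rexp (-t * ⟪y, x⟫))) (stdGaussian E) :=
    ((integrable_exp_stdGaussian_inner x t).add
      (integrable_exp_stdGaussian_inner x (-t))).const_mul _
  calc ∫⁻ y, ENNReal.ofReal (⟪y, x⟫ ^ (2 * k)) ∂(stdGaussian E)
      ≤ ∫⁻ y, ENNReal.ofReal (((2 * k).factorial / t ^ (2 * k)) *
      (rexp (t * ⟪y, x⟫) + rexp (-t * ⟪y, x⟫))) ∂(stdGaussian E) :=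
        lintegral_mono fun y => ENNReal.ofReal_le_ofReal (hpt _)
    _ = ENNReal.ofReal (((2 * k).factorial / t ^ (2 * k)) *
          (2 * rexp (‖x‖ ^ 2 * t ^ 2 / 2))) := by
        rw [← ofReal_integral_eq_lintegral_ofReal hint (ae_of_all _ fun y => by positivity),
          integral_const_mul, integral_add (integrable_exp_stdGaussian_inner x t)
          (integrable_exp_stdGaussian_inner x (-t))]
        have h1 := mgf_stdGaussian_inner x t
        have h2 := mgf_stdGaussian_inner x (-t)
        rw [mgf] at h1 h2
        rw [h1, h2, neg_sq, ← two_mul]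
    _ ≤ _ := by
        apply ENNReal.ofReal_le_ofReal
        have e1 : rexp (‖x‖ ^ 2 * t ^ 2 / 2) ≤ 3 ^ k := by
          have : ‖x‖ ^ 2 * t ^ 2 / 2 ≤ k := by
            rw [ht2]
            have : ‖x‖ ^ 2 ≤ r ^ 2 := by gcongr
            rw [div_le_iff₀ (by norm_num), mul_div_assoc', div_le_iff₀ (by positivity)]
            nlinarith
          calc rexp (‖x‖ ^ 2 * t ^ 2 / 2) ≤ rexp (k * 1) := by apply exp_le_exp.2; linarith
            _ = rexp 1 ^ k := by rw [exp_nat_mul]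
            _ ≤ 3 ^ k := by have := Real.exp_one_lt_d9; gcongr; linarith
        have e2 : (((2 * k).factorial : ℕ) : ℝ) ≤ (2 * k) ^ (2 * k) := by
          exact_mod_cast Nat.factorial_le_pow (2 * k)
        have e3 : t ^ (2 * k) = (2 * k / r ^ 2) ^ k := by rw [pow_mul, ht2]
        have e4 : (2 : ℝ) ≤ 2 ^ k := by
          calc (2 : ℝ) = 2 ^ 1 := by norm_num
            _ ≤ 2 ^ k := pow_le_pow_right₀ (by norm_num) hk
        calc _ ≤ ((2 * k : ℝ) ^ (2 * k) / t ^ (2 * k)) * (2 ^ k * 3 ^ k) := by gcongr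
          _ = _ := by
            rw [e3, pow_mul, ← div_pow, ← mul_pow, ← mul_pow]
            congr 1
            field_simp
            ring

lemma stdGaussian_prod_map_rotation :
    ((stdGaussian E).prod (stdGaussian E)).map (ContinuousLinearMap.rotation (π / 4)) =
      (stdGaussian E).prod (stdGaussian E) :=
  IsGaussian.map_rotation_eq_self_of_forall_strongDual_eq_zero
    integral_strongDual_stdGaussian _

end Gaussian

/-- A log-concave measure, tested on measurable sets. -/
def LogConcaveMeasure {E : Type*} [AddCommGroup E] [Module ℝ E] [MeasurableSpace E]
    (ν : Measure E) : Prop :=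
  ∀ K L M : Set E, MeasurableSet K → MeasurableSet L → MeasurableSet M →
    ∀ a : ℝ, 0 < a → a < 1 → (∀ x ∈ K, ∀ y ∈ L, a • x + (1 - a) • y ∈ M) →
      ν.real K ^ a * ν.real L ^ (1 - a) ≤ ν.real M

lemma IsLogConcave.logConcaveMeasure_map {n : ℕ} {μ : Measure Ω} [IsProbabilityMeasure μ]
    {X : Ω → EuclideanSpace ℝ (Fin n)} (hX : Measurable X) (h : IsLogConcave μ X) :
    LogConcaveMeasure (μ.map X) := by
  intro K L M hK hL hM a ha0 ha1 hKLM
  have := Measure.isProbabilityMeasure_map (μ := μ) hX.aemeasurable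
  set ν := μ.map X
  rcases (measureReal_nonneg (μ := ν) (s := K)).eq_or_lt with hK0 | hK0
  · rw [← hK0, zero_rpow ha0.ne', zero_mul]; exact measureReal_nonneg
  rcases (measureReal_nonneg (μ := ν) (s := L)).eq_or_lt with hL0 | hL0
  · rw [← hL0, zero_rpow (by linarith : 1 - a ≠ 0), mul_zero]; exact measureReal_nonneg
  have approx : ∀ S : Set (EuclideanSpace ℝ (Fin n)), MeasurableSet S → 0 < ν.real S →
      ∀ t : ℝ, 0 < t → t < 1 → ∃ S' ⊆ S, IsCompact S' ∧ S'.Nonempty ∧ t * ν.real S ≤ ν.real S' := by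
    intro S hS hS0 t ht0 ht1
    have hlt : ENNReal.ofReal (t * ν.real S) < ν S := by
      rw [← ofReal_measureReal]
      apply (ENNReal.ofReal_lt_ofReal_iff hS0).2
      nlinarith
    obtain ⟨S', hS', hc, hlt'⟩ := hS.exists_lt_isCompact hlt
    refine ⟨S', hS', hc, ?_, ?_⟩
    · rw [Set.nonempty_iff_ne_empty]
      rintro rfl
      simp at hlt'
    · exact (ENNReal.ofReal_le_iff_le_toReal (measure_ne_top _ _)).1 hlt'.le
  have hpre : ∀ S : Set (EuclideanSpace ℝ (Fin n)), MeasurableSet S →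
      (μ (X ⁻¹' S)).toReal = ν.real S := fun S hS => (map_measureReal_apply hX hS).symm
  have key : ∀ t : ℝ, 0 < t → t < 1 → t * (ν.real K ^ a * ν.real L ^ (1 - a)) ≤ ν.real M := by
    intro t ht0 ht1
    obtain ⟨K', hK', hKc, hKn, hKt⟩ := approx K hK hK0 t ht0 ht1
    obtain ⟨L', hL', hLc, hLn, hLt⟩ := approx L hL hL0 t ht0 ht1
    have h1 := h K' L' hKn hLn hKc hLc a ha0.le ha1.le
    rw [hpre _ hKc.measurableSet, hpre _ hLc.measurableSet,
      hpre _ ((hKc.smul a).add (hLc.smul (1 - a))).measurableSet] at h1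
    have hsub : a • K' + (1 - a) • L' ⊆ M := by
      rintro _ ⟨_, ⟨x, hx, rfl⟩, _, ⟨y, hy, rfl⟩, rfl⟩
      exact hKLM x (hK' hx) y (hL' hy)
    calc t * (ν.real K ^ a * ν.real L ^ (1 - a))
        = (t * ν.real K) ^ a * (t * ν.real L) ^ (1 - a) := by
          rw [mul_rpow ht0.le hK0.le, mul_rpow ht0.le hL0.le]
          have : t ^ a * t ^ (1 - a) = t := by rw [← rpow_add ht0]; simp
          linear_combination (-(ν.real K ^ a * ν.real L ^ (1 - a))) * this
      _ ≤ ν.real K' ^ a * ν.real L' ^ (1 - a) := by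
          have : 0 ≤ 1 - a := by linarith
          gcongr
      _ ≤ _ := h1
      _ ≤ _ := measureReal_mono hsub
  have htend : Filter.Tendsto (fun t : ℝ => t * (ν.real K ^ a * ν.real L ^ (1 - a)))
      (nhdsWithin 1 (Set.Iio 1)) (nhds (1 * (ν.real K ^ a * ν.real L ^ (1 - a)))) :=
    (Filter.Tendsto.mul_const _ Filter.tendsto_id).mono_left nhdsWithin_le_nhds
  rw [one_mul] at htend
  refine le_of_tendsto htend ?_
  filter_upwards [Ioo_mem_nhdsLT (show (0 : ℝ) < 1 by norm_num)] with t ht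
  exact key t ht.1 ht.2

lemma LogConcaveMeasure.restrict {E : Type*} [AddCommGroup E] [Module ℝ E]
    [MeasurableSpace E] {ν : Measure E} (h : LogConcaveMeasure ν)
    {B : Set E} (hB : MeasurableSet B) (hc : Convex ℝ B) : LogConcaveMeasure (ν.restrict B) := by
  intro K L M hK hL hM a ha0 ha1 hKLM
  rw [measureReal_restrict_apply hK, measureReal_restrict_apply hL, measureReal_restrict_apply hM]
  refine h _ _ _ (hK.inter hB) (hL.inter hB) (hM.inter hB) a ha0 ha1 fun x hx y hy =>
    ⟨hKLM x hx.1 y hy.1, hc hx.2 hy.2 ha0.le (by linarith) (by ring)⟩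

section LogConcave

variable {E : Type*} [NormedAddCommGroup E] [InnerProductSpace ℝ E]
  [MeasurableSpace E] [BorelSpace E] {F : Type*} [NormedAddCommGroup F] [NormedSpace ℝ F]

lemma LogConcaveMeasure.map {ν : Measure E} [IsFiniteMeasure ν] (h : LogConcaveMeasure ν)
    (f : E →L[ℝ] E) : LogConcaveMeasure (ν.map f) := by
  intro K L M hK hL hM a ha0 ha1 hKLM
  have hf := f.continuous.measurable
  rw [map_measureReal_apply hf hK, map_measureReal_apply hf hL, map_measureReal_apply hf hM]
  refine h _ _ _ (hf hK) (hf hL) (hf hM) a ha0 ha1 fun x hx y hy => ?_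
  simpa using hKLM _ hx _ hy

lemma measurableSet_le_norm_clm (f : E →L[ℝ] F) (r : ℝ) : MeasurableSet {x | r ≤ ‖f x‖} :=
  (isClosed_le continuous_const f.continuous.norm).measurableSet

/-- **Borell's lemma.** -/
lemma LogConcaveMeasure.borell {ν : Measure E} [IsFiniteMeasure ν] (h : LogConcaveMeasure ν)
    (f : E →L[ℝ] F) {r p : ℝ} (hp : 1 ≤ p)
    (hr : ν.real {x | r ≤ ‖f x‖} ≤ 7 / 10 * rexp (-p) * ν.real Set.univ) {t : ℝ} (ht : 1 ≤ t) :
    ν.real {x | t * r ≤ ‖f x‖} ≤ 7 / 10 * ν.real Set.univ * rexp (-(p * ((t + 1) / 2))) := by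
  set T := ν.real Set.univ with hT
  rcases ht.eq_or_lt with rfl | ht
  · convert hr using 1
    · simp
    · norm_num; ring
  rcases (measureReal_nonneg (μ := ν) (s := Set.univ)).eq_or_lt with hT0 | hT0
  · rw [hT, ← hT0]
    have := measureReal_mono (μ := ν) (Set.subset_univ {x | t * r ≤ ‖f x‖})
    simp; linarith
  set a : ℝ := 2 / (t + 1) with ha
  have ha0 : 0 < a := by positivity
  have ha1 : a < 1 := by rw [ha, div_lt_one (by linarith)]; linarith
  have hLm : MeasurableSet {x | ‖f x‖ < r} :=
    (isOpen_lt f.continuous.norm continuous_const).measurableSet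
  have hL : 7 / 10 * T ≤ ν.real {x | ‖f x‖ < r} := by
    have : {x | ‖f x‖ < r} = {x | r ≤ ‖f x‖}ᶜ := by ext; simp
    rw [this, measureReal_compl (measurableSet_le_norm_clm f r), ← hT]
    have : rexp (-p) ≤ 3 / 7 := by
      have h1 : rexp (-p) ≤ rexp (-1) := by gcongr
      have h2 := Real.exp_neg_one_lt_d9
      linarith
    have := mul_le_mul_of_nonneg_right this hT0.le
    rw [← hT] at this
    linarith
  have h1 := h _ _ _ (measurableSet_le_norm_clm f (t * r)) hLm (measurableSet_le_norm_clm f r)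
    a ha0 ha1 (by
      intro x (hx : t * r ≤ ‖f x‖) y (hy : ‖f y‖ < r)
      show r ≤ ‖f (a • x + (1 - a) • y)‖
      have e1 : ‖a • f x‖ = a * ‖f x‖ := by rw [norm_smul, norm_of_nonneg ha0.le]
      have e2 : ‖(1 - a) • f y‖ = (1 - a) * ‖f y‖ := by
        rw [norm_smul, norm_of_nonneg (by linarith)]
      have e3 := norm_sub_le (a • f x + (1 - a) • f y) ((1 - a) • f y)
      rw [add_sub_cancel_right, e1, e2] at e3
      rw [map_add, map_smul, map_smul]
      have e4 : a * (t * r) ≤ a * ‖f x‖ := by gcongr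
      have e5 : (1 - a) * ‖f y‖ ≤ (1 - a) * r :=
        mul_le_mul_of_nonneg_left hy.le (by linarith)
      have e6 : a * (t * r) - (1 - a) * r = r := by rw [ha]; field_simp; ring
      linarith)
  have h2 : ν.real {x | t * r ≤ ‖f x‖} ^ a * (7 / 10 * T) ^ (1 - a) ≤ 7 / 10 * rexp (-p) * T := by
    refine le_trans ?_ (h1.trans hr)
    have : 0 ≤ 1 - a := by linarith
    gcongr
  have h3 : (7 / 10 * T) ^ a * (7 / 10 * T) ^ (1 - a) = 7 / 10 * T := by
    rw [← rpow_add (by positivity)]; simp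
  have h4 : 0 < (7 / 10 * T) ^ (1 - a) := by positivity
  rw [← rpow_le_rpow_iff measureReal_nonneg (by positivity) ha0, mul_rpow (by positivity)
    (by positivity), ← exp_mul]
  have h5 : -(p * ((t + 1) / 2)) * a = -p := by rw [ha]; field_simp
  rw [h5]
  refine le_of_mul_le_mul_right (h2.trans (le_of_eq ?_)) h4
  linear_combination (-rexp (-p)) * h3

lemma LogConcaveMeasure.borell' {ν : Measure E} [IsFiniteMeasure ν] (h : LogConcaveMeasure ν)
    (f : E →L[ℝ] F) {r : ℝ} (hr0 : 0 < r)
    (hr : ν.real {x | r ≤ ‖f x‖} ≤ 1 / 4 * ν.real Set.univ) (s : ℝ) :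
    ν.real {x | s ≤ ‖f x‖} ≤ 2 * ν.real Set.univ * rexp (-(s / (2 * r))) := by
  set T := ν.real Set.univ with hT
  have hT0 : 0 ≤ T := measureReal_nonneg
  rcases le_or_gt r s with hs | hs
  · have h1 := h.borell f le_rfl (r := r) (hr.trans (by
      have := Real.exp_neg_one_gt_d9
      gcongr; linarith)) (t := s / r) (by rwa [le_div_iff₀ hr0, one_mul])
    rw [div_mul_cancel₀ _ hr0.ne'] at h1
    refine h1.trans ?_
    have : rexp (-(1 * ((s / r + 1) / 2))) ≤ rexp (-(s / (2 * r))) := by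
      apply exp_le_exp.2
      have : s / (2 * r) = s / r / 2 := by field_simp
      rw [this]; linarith
    gcongr
    norm_num
  · have h1 : 1 / 2 ≤ rexp (-(s / (2 * r))) := by
      have : s / (2 * r) ≤ 1 / 2 := by rw [div_le_iff₀ (by positivity)]; linarith
      have h2 := Real.add_one_le_exp (-(s / (2 * r)))
      linarith
    calc _ ≤ T := measureReal_mono (Set.subset_univ _)
      _ ≤ 2 * T * rexp (-(s / (2 * r))) := by nlinarith

lemma lintegral_norm_pow_le {ν : Measure E} [IsFiniteMeasure ν] (f : E →L[ℝ] F)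
    {r b T : ℝ} (hr : 0 < r) (hb : 1 / 2 ≤ b) (hT : ν.real Set.univ ≤ T)
    (h : ∀ t : ℝ, 1 ≤ t → ν.real {x | t * r ≤ ‖f x‖} ≤ T * rexp (-(b * t))) (k : ℕ) :
    ∫⁻ x, ENNReal.ofReal (‖f x‖ ^ k) ∂ν ≤
      ENNReal.ofReal (5 * rexp (b / 2) * (2 * r * k / b) ^ k * T) := by
  have hT0 : 0 ≤ T := measureReal_nonneg.trans hT
  have hb0 : 0 < b := by linarith
  set c : ℝ := (2 * r * k / b) ^ k with hc
  have hc0 : 0 ≤ c := by positivity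
  have hpt : ∀ z : ℝ, 0 ≤ z → z ^ k ≤ c * rexp (b * z / (2 * r)) := by
    intro z hz
    have h1 := Real.pow_div_factorial_le_exp (b * z / (2 * r)) (by positivity) k
    rw [div_le_iff₀ (by positivity)] at h1
    have h2 : ((k.factorial : ℕ) : ℝ) ≤ k ^ k := by exact_mod_cast Nat.factorial_le_pow k
    calc z ^ k = (2 * r / b) ^ k * (b * z / (2 * r)) ^ k := by
          rw [← mul_pow]; congr 1; field_simp
      _ ≤ (2 * r / b) ^ k * (rexp (b * z / (2 * r)) * k ^ k) := by
          gcongr; exact h1.trans (by gcongr)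
      _ = _ := by rw [hc, mul_div_right_comm, mul_pow]; ring
  set g : ℕ → E → ℝ≥0∞ := fun j => Set.indicator {x | (j : ℝ) * r ≤ ‖f x‖}
    (fun _ => ENNReal.ofReal (c * rexp (b * (j + 1) / 2))) with hg
  have hle : ∀ x, ENNReal.ofReal (‖f x‖ ^ k) ≤ ∑' j, g j x := by
    intro x
    refine le_trans ?_ (ENNReal.le_tsum ⌊‖f x‖ / r⌋₊)
    have h1 : (⌊‖f x‖ / r⌋₊ : ℝ) ≤ ‖f x‖ / r := Nat.floor_le (by positivity)
    have h2 : ‖f x‖ / r < ⌊‖f x‖ / r⌋₊ + 1 := Nat.lt_floor_add_one _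
    rw [hg]
    simp only
    rw [Set.indicator_of_mem (by simpa [le_div_iff₀ hr] using h1)]
    apply ENNReal.ofReal_le_ofReal
    refine (hpt _ (norm_nonneg _)).trans ?_
    gcongr ?_ * rexp ?_
    have : b * ‖f x‖ / (2 * r) = b * (‖f x‖ / r) / 2 := by field_simp
    rw [this]
    gcongr
  have hint : ∀ j, ∫⁻ x, g j x ∂ν ≤ ENNReal.ofReal ((c * rexp (b / 2) * T) * rexp (-(b / 2)) ^ j) := by
    intro j
    rw [hg]
    simp only
    rw [lintegral_indicator_const (measurableSet_le_norm_clm f _), ← ofReal_measureReal,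
      ← ENNReal.ofReal_mul (by positivity)]
    apply ENNReal.ofReal_le_ofReal
    rw [← exp_nat_mul]
    have hm : ν.real {x | (j : ℝ) * r ≤ ‖f x‖} ≤ T * rexp (-(b * j)) := by
      rcases Nat.eq_zero_or_pos j with rfl | hj
      · simpa using (measureReal_mono (Set.subset_univ _)).trans hT
      · exact h j (by exact_mod_cast hj)
    calc _ ≤ c * rexp (b * (j + 1) / 2) * (T * rexp (-(b * j))) := by gcongr
      _ = c * T * (rexp (b * (j + 1) / 2) * rexp (-(b * j))) := by ring
      _ = c * T * (rexp (b / 2) * rexp (j * -(b / 2))) := by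
          rw [← exp_add, ← exp_add]; ring_nf
      _ = _ := by ring
  have hq : rexp (-(b / 2)) ≤ 4 / 5 := by
    have h1 : rexp (-(b / 2)) ≤ rexp (-(1 / 4)) := by apply exp_le_exp.2; linarith
    refine h1.trans ?_
    rw [exp_neg, inv_le_comm₀ (exp_pos _) (by norm_num)]
    have := Real.add_one_le_exp (1 / 4 : ℝ)
    norm_num at this ⊢
    linarith
  calc ∫⁻ x, ENNReal.ofReal (‖f x‖ ^ k) ∂ν ≤ ∫⁻ x, ∑' j, g j x ∂ν := lintegral_mono hle
    _ = ∑' j, ∫⁻ x, g j x ∂ν := lintegral_tsum fun j =>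
        (measurable_const.indicator (measurableSet_le_norm_clm f _)).aemeasurable
    _ ≤ ∑' j : ℕ, ENNReal.ofReal ((c * rexp (b / 2) * T) * rexp (-(b / 2)) ^ j) :=
        ENNReal.tsum_le_tsum hint
    _ = ENNReal.ofReal ((c * rexp (b / 2) * T) * (1 - rexp (-(b / 2)))⁻¹) := by
        have hs : HasSum (fun j : ℕ => (c * rexp (b / 2) * T) * rexp (-(b / 2)) ^ j) _ :=
          (hasSum_geometric_of_lt_one (exp_pos _).le (by linarith)).mul_left _
        rw [← ENNReal.ofReal_tsum_of_nonneg (fun j => by positivity) hs.summable, hs.tsum_eq]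
    _ ≤ _ := by
        apply ENNReal.ofReal_le_ofReal
        have : (1 - rexp (-(b / 2)))⁻¹ ≤ 5 := by
          rw [inv_le_comm₀ (by linarith) (by norm_num)]; linarith
        calc _ ≤ (c * rexp (b / 2) * T) * 5 := by gcongr
          _ = _ := by ring

end LogConcave

lemma tangent_le_pow_two_mul (a c : ℝ) (m : ℕ) :
    a ^ (2 * m) + 2 * m * a ^ (2 * m - 1) * (c - a) ≤ c ^ (2 * m) := by
  rcases Nat.eq_zero_or_pos m with rfl | hm
  · simp
  have hpos : 0 ≤ c ^ (2 * m) := (even_two_mul m).pow_nonneg c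
  rcases eq_or_ne a 0 with rfl | ha
  · rw [zero_pow (by omega), zero_pow (by omega)]; simpa using hpos
  have hap : 0 < a ^ (2 * m) := (even_two_mul m).pow_pos ha
  have key : 1 + ((2 * m : ℕ) : ℝ) * (c / a - 1) ≤ (c / a) ^ (2 * m) := by
    rcases le_or_gt (-2) (c / a - 1) with h | h
    · have := one_add_mul_le_pow h (2 * m)
      simpa using this
    · have h1 : (1 : ℝ) ≤ ((2 * m : ℕ) : ℝ) := by exact_mod_cast (by omega : 1 ≤ 2 * m)
      have h2 : 0 ≤ (c / a) ^ (2 * m) := (even_two_mul m).pow_nonneg _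
      nlinarith
  have e1 : a ^ (2 * m) = a ^ (2 * m - 1) * a := by
    rw [← pow_succ]; congr 1; omega
  have e2 : (c / a) ^ (2 * m) * a ^ (2 * m) = c ^ (2 * m) := by
    rw [← mul_pow, div_mul_cancel₀ _ ha]
  have h3 := mul_le_mul_of_nonneg_right key hap.le
  rw [e2] at h3
  refine le_trans (le_of_eq ?_) h3
  push_cast
  have e3 : c / a * a = c := div_mul_cancel₀ _ ha
  rw [e1]
  linear_combination (-(2 * m : ℝ) * a ^ (2 * m - 1)) * e3

section EvenMoment

variable {E : Type*} [NormedAddCommGroup E] [InnerProductSpace ℝ E] [MeasurableSpace E]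
  {κ : Measure E}

variable (κ) in
/-- The even moment `∫ ⟪y, x⟫ ^ (2 m) dκ(x)` of a linear functional. -/
def evenMoment (m : ℕ) (y : E) : ℝ := ∫ x, ⟪y, x⟫ ^ (2 * m) ∂κ

variable (κ) in
/-- The gradient direction `∫ ⟪y, x⟫ ^ (2 m - 1) x dκ(x)` of `evenMoment`. -/
def evenMomentGrad (m : ℕ) (y : E) : E := ∫ x, ⟪y, x⟫ ^ (2 * m - 1) • x ∂κ

lemma evenMoment_nonneg (m : ℕ) (y : E) : 0 ≤ evenMoment κ m y :=
  integral_nonneg fun _ => (even_two_mul m).pow_nonneg _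

lemma evenMoment_smul (m : ℕ) (c : ℝ) (y : E) :
    evenMoment κ m (c • y) = c ^ (2 * m) * evenMoment κ m y := by
  simp only [evenMoment, inner_smul_left, mul_pow]
  rw [integral_const_mul]
  simp

end EvenMoment

section BoundedSupport

variable {E : Type*} [NormedAddCommGroup E] [InnerProductSpace ℝ E] [FiniteDimensional ℝ E]
  [MeasurableSpace E] [BorelSpace E] {κ : Measure E} [IsFiniteMeasure κ] {b : ℝ}

lemma integrable_of_continuous_of_ae_norm_le {G : Type*} [NormedAddCommGroup G]
    [SecondCountableTopology G] (hb : ∀ᵐ x ∂κ, ‖x‖ ≤ b) {g : E → G} (hg : Continuous g) :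
    Integrable g κ := by
  obtain ⟨C, hC⟩ := (isCompact_closedBall (0 : E) b).exists_bound_of_continuousOn hg.continuousOn
  refine Integrable.of_bound (C := C) hg.aestronglyMeasurable ?_
  filter_upwards [hb] with x hx
  exact hC x (by simpa using hx)

lemma measurable_evenMoment (m : ℕ) : Measurable (evenMoment κ m) := by
  have : StronglyMeasurable (Function.uncurry fun (y x : E) => ⟪y, x⟫ ^ (2 * m)) := by
    apply Continuous.stronglyMeasurable
    unfold Function.uncurry
    fun_prop
  exact this.integral_prod_right.measurable

lemma inner_evenMomentGrad (hb : ∀ᵐ x ∂κ, ‖x‖ ≤ b) (m : ℕ) (y z : E) :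
    ⟪z, evenMomentGrad κ m y⟫ = ∫ x, ⟪y, x⟫ ^ (2 * m - 1) * ⟪z, x⟫ ∂κ := by
  rw [evenMomentGrad, ← integral_inner (integrable_of_continuous_of_ae_norm_le hb (by fun_prop))]
  simp only [inner_smul_right]

lemma evenMoment_tangent_le (hb : ∀ᵐ x ∂κ, ‖x‖ ≤ b) (m : ℕ) (hm : 1 ≤ m) (y z : E) :
    (1 - 2 * m) * evenMoment κ m y + 2 * m * ⟪z, evenMomentGrad κ m y⟫ ≤ evenMoment κ m z := by
  rw [inner_evenMomentGrad hb, evenMoment, evenMoment, ← integral_const_mul, ← integral_const_mul,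
    ← integral_add (integrable_of_continuous_of_ae_norm_le hb (by fun_prop))
    (integrable_of_continuous_of_ae_norm_le hb (by fun_prop))]
  refine integral_mono (integrable_of_continuous_of_ae_norm_le hb (by fun_prop))
    (integrable_of_continuous_of_ae_norm_le hb (by fun_prop)) fun x => ?_
  have h := tangent_le_pow_two_mul ⟪y, x⟫ ⟪z, x⟫ m
  have e1 : (⟪y, x⟫ : ℝ) ^ (2 * m) = ⟪y, x⟫ ^ (2 * m - 1) * ⟪y, x⟫ := by
    rw [← pow_succ]; congr 1; omega
  simp only
  rw [e1] at h ⊢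
  linarith

lemma norm_evenMomentGrad_le (hb : ∀ᵐ x ∂κ, ‖x‖ ≤ b) {m : ℕ} (hm : 1 ≤ m) {σ K : ℝ}
    (hK : 0 < K) (hσ : ∀ z, evenMoment κ m z ≤ (σ * ‖z‖) ^ (2 * m)) {y : E}
    (hy : (K * σ) ^ (2 * m) ≤ evenMoment κ m y) :
    ‖evenMomentGrad κ m y‖ ≤ evenMoment κ m y / K := by
  have hm' : (1 : ℝ) ≤ m := by exact_mod_cast hm
  set s := evenMomentGrad κ m y
  rcases eq_or_ne s 0 with hs | hs
  · rw [hs, norm_zero]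
    exact div_nonneg (evenMoment_nonneg _ _) hK.le
  have hs' : 0 < ‖s‖ := norm_pos_iff.2 hs
  have h := evenMoment_tangent_le hb m hm y ((K * ‖s‖⁻¹) • s)
  have h2 := hσ ((K * ‖s‖⁻¹) • s)
  have e : ‖(K * ‖s‖⁻¹) • s‖ = K := by
    rw [norm_smul, norm_of_nonneg (by positivity)]; field_simp
  rw [e] at h2
  have e2 : ⟪(K * ‖s‖⁻¹) • s, s⟫ = K * ‖s‖ := by
    rw [inner_smul_left, real_inner_self_eq_norm_sq]
    simp
    field_simp
  change _ + 2 * (m : ℝ) * ⟪(K * ‖s‖⁻¹) • s, s⟫ ≤ _ at h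
  rw [e2] at h
  rw [le_div_iff₀ hK]
  rw [mul_comm σ K] at h2
  have h3 : 2 * (m : ℝ) * (K * ‖s‖) ≤ 2 * m * evenMoment κ m y := by linarith
  have := le_of_mul_le_mul_left h3 (by positivity)
  linarith

lemma evenMoment_add_ge (hb : ∀ᵐ x ∂κ, ‖x‖ ≤ b) {m : ℕ} (hm : 1 ≤ m) {y z : E}
    (hz : -(evenMoment κ m y / 2) ≤ ⟪z, evenMomentGrad κ m y⟫) :
    evenMoment κ m y / 4 ^ m ≤ evenMoment κ m (y + z) := by
  have h := evenMoment_tangent_le hb m hm y ((2 : ℝ) • (y + z))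
  have e1 : ⟪y, evenMomentGrad κ m y⟫ = evenMoment κ m y := by
    rw [inner_evenMomentGrad hb, evenMoment]
    congr 1
    ext x
    rw [← pow_succ]; congr 1; omega
  rw [evenMoment_smul, inner_smul_left, inner_add_left, e1, pow_mul] at h
  norm_num at h
  rw [div_le_iff₀ (by positivity)]
  have : 0 ≤ (4 * m : ℝ) * (⟪z, evenMomentGrad κ m y⟫ + evenMoment κ m y / 2) :=
    mul_nonneg (by positivity) (by linarith)
  nlinarith

lemma stdGaussian_evenMoment_add_lt (hb : ∀ᵐ x ∂κ, ‖x‖ ≤ b) {m : ℕ} (hm : 1 ≤ m) {σ K : ℝ}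
    (hσ0 : 0 < σ) (hK : 0 < K) (hσ : ∀ z, evenMoment κ m z ≤ (σ * ‖z‖) ^ (2 * m)) {y : E}
    (hy : (K * σ) ^ (2 * m) ≤ evenMoment κ m y) :
    (stdGaussian E).real {z | evenMoment κ m (y + z) < evenMoment κ m y / 4 ^ m} ≤
      rexp (-(K ^ 2 / 8)) := by
  have hA : 0 < evenMoment κ m y := lt_of_lt_of_le (by positivity) hy
  have hs := norm_evenMomentGrad_le hb hm hK hσ hy
  have h := stdGaussian_inner_tail (-evenMomentGrad κ m y) (r := evenMoment κ m y / K)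
    (u := evenMoment κ m y / 2) (by positivity) (by rwa [norm_neg]) (by positivity)
  have e : (evenMoment κ m y / 2) ^ 2 / (2 * (evenMoment κ m y / K) ^ 2) = K ^ 2 / 8 := by
    field_simp; norm_num
  rw [e] at h
  refine (measureReal_mono fun z hz => ?_).trans h
  simp only [Set.mem_ofPred_eq, inner_neg_right] at hz ⊢
  by_contra hcon
  exact absurd (evenMoment_add_ge hb hm (z := z) (by linarith)) (not_le.2 hz)

/-- Gaussian self-improvement: if the even moment is large with a small probability, it is
of comparable size with overwhelming probability. -/
lemma stdGaussian_evenMoment_dichotomy (hb : ∀ᵐ x ∂κ, ‖x‖ ≤ b) {m : ℕ} (hm : 1 ≤ m) {σ M : ℝ}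
    (hσ0 : 0 < σ) (hM : 0 < M) (hσ : ∀ z, evenMoment κ m z ≤ (σ * ‖z‖) ^ (2 * m)) :
    (stdGaussian E).real {y | M ^ (2 * m) ≤ evenMoment κ m y} *
      (stdGaussian E).real {y | evenMoment κ m y < (M / 8) ^ (2 * m)} ≤
      2 * rexp (-((M / (3 * σ)) ^ 2 / 8)) := by
  set γ := stdGaussian E with hγ
  set ε := rexp (-((M / (3 * σ)) ^ 2 / 8)) with hε
  have hA := measurable_evenMoment (κ := κ) m
  set Bad : Set (E × E) := {q | (M / 3) ^ (2 * m) ≤ evenMoment κ m q.1 ∧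
    evenMoment κ m (q.1 + q.2) < evenMoment κ m q.1 / 4 ^ m} with hBad
  have hBadm : MeasurableSet Bad := by
    exact (measurableSet_le measurable_const (hA.comp measurable_fst)).inter
      (measurableSet_lt (hA.comp (measurable_fst.add measurable_snd))
        ((hA.comp measurable_fst).div_const _))
  have hBadle : (γ.prod γ) Bad ≤ ENNReal.ofReal ε := by
    rw [Measure.prod_apply hBadm]
    calc ∫⁻ y, γ (Prod.mk y ⁻¹' Bad) ∂γ ≤ ∫⁻ y, ENNReal.ofReal ε ∂γ := by
          refine lintegral_mono fun y => ?_
          by_cases hy : (M / 3) ^ (2 * m) ≤ evenMoment κ m y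
          · have h := stdGaussian_evenMoment_add_lt hb hm (K := M / (3 * σ)) hσ0 (by positivity)
              hσ (y := y) (by convert hy using 2; field_simp)
            refine le_trans (measure_mono ?_) ((ENNReal.le_ofReal_iff_toReal_le
              (measure_ne_top _ _) (exp_pos _).le).2 h)
            exact fun z hz => hz.2
          · have : Prod.mk y ⁻¹' Bad = ∅ := by
              ext z; simp [hBad, hy]
            simp [this]
      _ = _ := by simp
  have hrot : (γ.prod γ) ((ContinuousLinearMap.rotation (π / 4)) ⁻¹' Bad) ≤ ENNReal.ofReal ε := by
    rw [← Measure.map_apply (by fun_prop) hBadm, stdGaussian_prod_map_rotation]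
    exact hBadle
  have hsub : {y | M ^ (2 * m) ≤ evenMoment κ m y} ×ˢ {y | evenMoment κ m y < (M / 8) ^ (2 * m)} ⊆
      Bad ∪ (ContinuousLinearMap.rotation (π / 4)) ⁻¹' Bad := by
    rintro ⟨y, z⟩ ⟨hy, hz⟩
    simp only [Set.mem_ofPred_eq] at hy hz
    by_contra hcon
    simp only [Set.mem_union, not_or, Set.mem_preimage, hBad, Set.mem_ofPred_eq, not_and,
      not_lt, ContinuousLinearMap.rotation_apply, cos_pi_div_four, sin_pi_div_four] at hcon
    obtain ⟨h1, h2⟩ := hcon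
    have h3 := h1 (le_trans (pow_le_pow_left₀ (by positivity) (by linarith) _) hy)
    have e1 : (√2 / 2) • y + (√2 / 2) • z = (√2 / 2) • (y + z) := by rw [smul_add]
    have e2 : (√2 / 2) • y + (√2 / 2) • z + (-(√2 / 2) • y + (√2 / 2) • z) = √2 • z := by
      module
    have hs : (√2 : ℝ) ^ 2 = 2 := Real.sq_sqrt (by norm_num)
    have hs2 : (√2 / 2 : ℝ) ^ (2 * m) = (1 / 2) ^ m := by
      rw [pow_mul, div_pow, hs]; norm_num
    have hs3 : (√2 : ℝ) ^ (2 * m) = 2 ^ m := by rw [pow_mul, hs]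
    rw [e2, e1, evenMoment_smul, evenMoment_smul, hs2, hs3] at h2
    have p1 : ((1 : ℝ) / 2) ^ m * evenMoment κ m (y + z) ≥ (M ^ 2 / 8) ^ m := by
      calc (M ^ 2 / 8) ^ m = (1 / 2) ^ m * (M ^ (2 * m) / 4 ^ m) := by
            rw [pow_mul, ← div_pow, ← mul_pow]; congr 1; ring
        _ ≤ _ := by
            refine mul_le_mul_of_nonneg_left (le_trans ?_ h3) (by positivity)
            gcongr
    have h4 := h2 (by
      refine le_trans ?_ p1
      rw [pow_mul]
      apply pow_le_pow_left₀ (by positivity)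
      nlinarith [sq_nonneg M])
    have h5 : (2 : ℝ) ^ m * evenMoment κ m z < (M ^ 2 / 32) ^ m := by
      calc (2 : ℝ) ^ m * evenMoment κ m z < 2 ^ m * (M / 8) ^ (2 * m) := by gcongr
        _ = (M ^ 2 / 32) ^ m := by rw [pow_mul, ← mul_pow]; congr 1; ring
    have h6 : (M ^ 2 / 32) ^ m ≤ (1 / 2 : ℝ) ^ m * evenMoment κ m (y + z) / 4 ^ m := by
      rw [le_div_iff₀ (by positivity), ← mul_pow, show M ^ 2 / 32 * 4 = M ^ 2 / 8 by ring]
      exact p1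
    linarith
  have h := (measure_mono hsub).trans ((measure_union_le (μ := γ.prod γ) _ _).trans
    (add_le_add hBadle hrot))
  rw [Measure.prod_prod, ← ofReal_measureReal, ← ofReal_measureReal,
    ← ENNReal.ofReal_mul measureReal_nonneg, ← ENNReal.ofReal_add (exp_pos _).le (exp_pos _).le,
    ENNReal.ofReal_le_ofReal_iff (by positivity)] at h
  linarith

end BoundedSupport

section SwappedMarkov

variable {Y Z : Type*} [MeasurableSpace Y] [MeasurableSpace Z] {γ : Measure Y} {κ : Measure Z}
  [IsProbabilityMeasure γ] [IsFiniteMeasure κ] {S : Set (Y × Z)}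

lemma lintegral_slice_swap (hS : MeasurableSet S) :
    ∫⁻ y, κ {x | (y, x) ∈ S} ∂γ = ∫⁻ x, γ {y | (y, x) ∈ S} ∂κ :=
  (Measure.prod_apply hS).symm.trans (Measure.prod_apply_symm hS)

lemma measureReal_le_slice_le (hS : MeasurableSet S) {δ c : ℝ} (hδ : 0 ≤ δ) (hc : 0 < c)
    (hκ : κ.real Set.univ ≤ 1) (h : ∀ x, γ.real {y | (y, x) ∈ S} ≤ δ) :
    γ.real {y | c ≤ κ.real {x | (y, x) ∈ S}} ≤ δ / c := by
  have h1 : ∫⁻ y, κ {x | (y, x) ∈ S} ∂γ ≤ ENNReal.ofReal δ := by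
    rw [lintegral_slice_swap hS]
    calc ∫⁻ x, γ {y | (y, x) ∈ S} ∂κ ≤ ∫⁻ x, ENNReal.ofReal δ ∂κ := lintegral_mono fun x =>
          (ENNReal.le_ofReal_iff_toReal_le (measure_ne_top _ _) hδ).2 (h x)
      _ ≤ _ := by
          rw [lintegral_const, ← ofReal_measureReal, ← ENNReal.ofReal_mul hδ]
          exact ENNReal.ofReal_le_ofReal (mul_le_of_le_one_right hδ hκ)
  have h2 := mul_meas_ge_le_lintegral (μ := γ) (measurable_measure_prodMk_left (ν := κ) hS)
    (ENNReal.ofReal c)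
  have h3 : {y | c ≤ κ.real {x | (y, x) ∈ S}} = {y | ENNReal.ofReal c ≤ κ (Prod.mk y ⁻¹' S)} := by
    ext y
    exact (ENNReal.ofReal_le_iff_le_toReal (measure_ne_top _ _)).symm
  rw [← h3, ← ofReal_measureReal, ← ENNReal.ofReal_mul hc.le] at h2
  have h4 := (ENNReal.ofReal_le_ofReal_iff hδ).1 (h2.trans h1)
  rw [le_div_iff₀ hc]; linarith

lemma le_measureReal_le_slice (hS : MeasurableSet S) {δ T : ℝ} (hδ : 0 ≤ δ) (hT0 : 0 < T)
    (hT : κ.real Set.univ = T) (h : ∀ᵐ x ∂κ, δ ≤ γ.real {y | (y, x) ∈ S}) :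
    δ / 2 ≤ γ.real {y | T * δ / 2 ≤ κ.real {x | (y, x) ∈ S}} := by
  have h1 : ENNReal.ofReal (δ * T) ≤ ∫⁻ y, κ {x | (y, x) ∈ S} ∂γ := by
    rw [lintegral_slice_swap hS, ENNReal.ofReal_mul hδ, ← hT, ofReal_measureReal,
      ← lintegral_const]
    refine lintegral_mono_ae ?_
    filter_upwards [h] with x hx
    exact (ENNReal.ofReal_le_iff_le_toReal (measure_ne_top _ _)).2 hx
  have hm : MeasurableSet {y | T * δ / 2 ≤ κ.real {x | (y, x) ∈ S}} :=
    measurableSet_le measurable_const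
      (measurable_measure_prodMk_left (ν := κ) hS).ennreal_toReal
  set G := {y | T * δ / 2 ≤ κ.real {x | (y, x) ∈ S}} with hG
  have h2 : ∫⁻ y, κ {x | (y, x) ∈ S} ∂γ ≤ ENNReal.ofReal (T * γ.real G + T * δ / 2) := by
    calc ∫⁻ y, κ {x | (y, x) ∈ S} ∂γ
        ≤ ∫⁻ y, G.indicator (fun _ => ENNReal.ofReal T) y + ENNReal.ofReal (T * δ / 2) ∂γ := by
          refine lintegral_mono fun y => ?_
          by_cases hy : y ∈ G
          · rw [Set.indicator_of_mem hy]
            refine le_trans ?_ le_self_add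
            rw [← hT, ofReal_measureReal]
            exact measure_mono (Set.subset_univ _)
          · rw [Set.indicator_of_notMem hy, zero_add]
            exact (ENNReal.le_ofReal_iff_toReal_le (measure_ne_top _ _) (by positivity)).2
              (not_le.1 hy).le
      _ = _ := by
          rw [lintegral_add_right _ measurable_const, lintegral_indicator_const hm,
            lintegral_const, measure_univ, mul_one, ← ofReal_measureReal,
            ← ENNReal.ofReal_mul hT0.le, ← ENNReal.ofReal_add (by positivity) (by positivity)]
  have h3 := (ENNReal.ofReal_le_ofReal_iff (by positivity)).1 (h1.trans h2)
  nlinarith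

end SwappedMarkov

section NormTail

variable {E : Type*} [NormedAddCommGroup E] [InnerProductSpace ℝ E] [FiniteDimensional ℝ E]
  [MeasurableSpace E] [BorelSpace E]

lemma measurableSet_le_inner (u : ℝ) : MeasurableSet {q : E × E | u ≤ ⟪q.1, q.2⟫} :=
  (isClosed_le continuous_const (by fun_prop)).measurableSet

lemma stdGaussian_le_evenMoment {κ : Measure E} [IsFiniteMeasure κ] (hκ : κ.real Set.univ ≤ 1)
    {b : ℝ} (hb0 : 0 < b) (hb : ∀ᵐ x ∂κ, ‖x‖ ≤ b) {k : ℕ} (hk : 1 ≤ k) :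
    (stdGaussian E).real {y | 8 * (12 * k * b ^ 2) ^ k ≤ evenMoment κ k y} ≤ 1 / 8 := by
  have hk' : (1 : ℝ) ≤ k := by exact_mod_cast hk
  set Q : ℝ := (12 * k * b ^ 2) ^ k with hQ
  have hQ0 : 0 < Q := by positivity
  have hmeas : Measurable (Function.uncurry fun (y x : E) => ENNReal.ofReal (⟪y, x⟫ ^ (2 * k))) := by
    unfold Function.uncurry
    fun_prop
  have h1 : ∫⁻ y, ENNReal.ofReal (evenMoment κ k y) ∂(stdGaussian E) ≤ ENNReal.ofReal Q := by
    calc ∫⁻ y, ENNReal.ofReal (evenMoment κ k y) ∂(stdGaussian E)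
        = ∫⁻ y, ∫⁻ x, ENNReal.ofReal (⟪y, x⟫ ^ (2 * k)) ∂κ ∂(stdGaussian E) := by
          refine lintegral_congr fun y => ?_
          rw [evenMoment, ofReal_integral_eq_lintegral_ofReal
            (integrable_of_continuous_of_ae_norm_le hb (by fun_prop))
            (ae_of_all _ fun x => (even_two_mul k).pow_nonneg _)]
      _ = ∫⁻ x, ∫⁻ y, ENNReal.ofReal (⟪y, x⟫ ^ (2 * k)) ∂(stdGaussian E) ∂κ :=
          lintegral_lintegral_swap hmeas.aemeasurable
      _ ≤ ∫⁻ x, ENNReal.ofReal Q ∂κ := by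
          refine lintegral_mono_ae ?_
          filter_upwards [hb] with x hx
          exact stdGaussian_inner_moment x hk hb0 hx
      _ ≤ _ := by
          rw [lintegral_const, ← ofReal_measureReal, ← ENNReal.ofReal_mul hQ0.le]
          exact ENNReal.ofReal_le_ofReal (mul_le_of_le_one_right hQ0.le hκ)
  have h2 := mul_meas_ge_le_lintegral (μ := stdGaussian E)
    (measurable_evenMoment (κ := κ) k).ennreal_ofReal (ENNReal.ofReal (8 * Q))
  have h3 : {y | 8 * Q ≤ evenMoment κ k y} =
      {y | ENNReal.ofReal (8 * Q) ≤ ENNReal.ofReal (evenMoment κ k y)} := by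
    ext y
    exact (ENNReal.ofReal_le_ofReal_iff (evenMoment_nonneg k y)).symm
  rw [← h3, ← ofReal_measureReal, ← ENNReal.ofReal_mul (by positivity)] at h2
  have h4 := (ENNReal.ofReal_le_ofReal_iff hQ0.le).1 (h2.trans h1)
  nlinarith

/-- A Paley–Zygmund type inequality for linear functionals. -/
lemma le_measureReal_le_abs_inner {κ : Measure E} [IsFiniteMeasure κ] (hκ : κ.real Set.univ ≤ 1)
    {b : ℝ} (hb : ∀ᵐ x ∂κ, ‖x‖ ≤ b) {m : ℕ} (hm : 1 ≤ m) {τ Q : ℝ} (hτ : 0 < τ) (hQ : 0 < Q)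
    {y : E} (h1 : (2 * τ) ^ (2 * m) ≤ evenMoment κ m y) (h2 : evenMoment κ (2 * m) y ≤ Q) :
    τ ^ (4 * m) / (4 * Q) ≤ κ.real {x | τ ≤ |⟪y, x⟫|} := by
  set a := τ ^ (2 * m) with ha
  have ha0 : 0 < a := by positivity
  set H := 2 * Q / a with hH
  have hH0 : 0 < H := by positivity
  set B := {x : E | τ ≤ |⟪y, x⟫|} with hB
  have hBm : MeasurableSet B := (isClosed_le continuous_const (by fun_prop)).measurableSet
  have hpt : ∀ x : E, (⟪y, x⟫ : ℝ) ^ (2 * m) ≤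
      a + B.indicator (fun _ => H) x + H⁻¹ * ⟪y, x⟫ ^ (2 * (2 * m)) := by
    intro x
    have hu : 0 ≤ (⟪y, x⟫ : ℝ) ^ (2 * m) := (even_two_mul m).pow_nonneg _
    have e : (⟪y, x⟫ : ℝ) ^ (2 * (2 * m)) = (⟪y, x⟫ ^ (2 * m)) ^ 2 := by
      rw [← pow_mul]; congr 1; ring
    rw [e]
    set u := (⟪y, x⟫ : ℝ) ^ (2 * m) with hudef
    by_cases hx : x ∈ B
    · rw [Set.indicator_of_mem hx]
      have : H⁻¹ * u ^ 2 = (u - H) ^ 2 * H⁻¹ + 2 * u - H := by field_simp; ring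
      have : 0 ≤ (u - H) ^ 2 * H⁻¹ := by positivity
      rcases le_or_gt u H with h | h
      · have : 0 ≤ H⁻¹ * u ^ 2 := by positivity
        linarith
      · linarith
    · rw [Set.indicator_of_notMem hx]
      have : u ≤ a := by
        rw [hudef, ← (even_two_mul m).pow_abs]
        exact pow_le_pow_left₀ (abs_nonneg _) (not_le.1 hx).le _
      have : 0 ≤ H⁻¹ * u ^ 2 := by positivity
      linarith
  have hi : Integrable (B.indicator fun _ => H) κ := (integrable_const H).indicator hBm
  have hi2 : Integrable (fun x : E => H⁻¹ * ⟪y, x⟫ ^ (2 * (2 * m))) κ :=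
    integrable_of_continuous_of_ae_norm_le hb (by fun_prop)
  have hi3 : Integrable (fun x => a + B.indicator (fun _ => H) x) κ := (integrable_const a).add hi
  have h3 : evenMoment κ m y ≤ a * κ.real Set.univ + H * κ.real B
      + H⁻¹ * evenMoment κ (2 * m) y := by
    calc evenMoment κ m y ≤ ∫ x, a + B.indicator (fun _ => H) x
          + H⁻¹ * ⟪y, x⟫ ^ (2 * (2 * m)) ∂κ :=
          integral_mono (integrable_of_continuous_of_ae_norm_le hb (by fun_prop))
            (hi3.add hi2) hpt
      _ = _ := by
          rw [integral_add hi3 hi2,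
            integral_add (integrable_const a) hi, integral_indicator_const _ hBm,
            integral_const_mul]
          simp [evenMoment, mul_comm]
  have h4 : 4 * a ≤ (2 * τ) ^ (2 * m) := by
    rw [mul_pow, pow_mul, ha]
    gcongr
    calc (4 : ℝ) = (2 ^ 2) ^ 1 := by norm_num
      _ ≤ (2 ^ 2) ^ m := pow_le_pow_right₀ (by norm_num) hm
  have h5 : H⁻¹ * evenMoment κ (2 * m) y ≤ a / 2 := by
    calc H⁻¹ * evenMoment κ (2 * m) y ≤ H⁻¹ * Q := by gcongr
      _ = a / 2 := by rw [hH]; field_simp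
  have h6 : a * κ.real Set.univ ≤ a := mul_le_of_le_one_right ha0.le hκ
  have h7 : a ≤ H * κ.real B := by linarith
  have e : τ ^ (4 * m) = a * a := by rw [ha, ← pow_add]; congr 1; ring
  rw [div_le_iff₀ (by positivity), e]
  have h8 : a * a ≤ a * (H * κ.real B) := by gcongr
  have h9 : a * (H * κ.real B) = κ.real B * (2 * Q) := by rw [hH]; field_simp
  have : 0 ≤ κ.real B := measureReal_nonneg
  nlinarith

end NormTail

lemma LogConcaveMeasure.le_measureReal_annulus {E : Type*} [NormedAddCommGroup E]
    [InnerProductSpace ℝ E] [MeasurableSpace E] [BorelSpace E] {ν : Measure E}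
    [IsProbabilityMeasure ν] (h : LogConcaveMeasure ν)
    {R δ : ℝ} (hδ : ν.real {x | R ≤ ‖x‖} = δ) (hδ0 : 0 < δ) (hδ1 : δ ≤ 1 / 4) :
    δ / 2 ≤ ν.real {x | R ≤ ‖x‖ ∧ ‖x‖ < 5 * R} := by
  set p := Real.log (7 / 10 / δ) with hp
  have hlog : rexp (-p) = δ / (7 / 10) := by
    rw [hp, ← Real.log_inv, Real.exp_log (by positivity), inv_div]
  have hp1 : 1 ≤ p := by
    have h1 : rexp (-p) ≤ rexp (-1) := by
      rw [hlog]
      have := Real.exp_neg_one_gt_d9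
      linarith
    linarith [exp_le_exp.1 h1]
  have hb := h.borell (ContinuousLinearMap.id ℝ E) hp1 (r := R) (by
    simp only [ContinuousLinearMap.id_apply, probReal_univ]
    rw [hδ, hlog]; linarith) (t := 5) (by norm_num)
  simp only [ContinuousLinearMap.id_apply, probReal_univ] at hb
  have e : rexp (-(p * ((5 + 1) / 2))) = (δ / (7 / 10)) ^ 3 := by
    rw [← hlog, ← exp_nat_mul]; congr 1; push_cast; ring
  rw [e] at hb
  have hsub : {x : E | R ≤ ‖x‖} ⊆ {x | R ≤ ‖x‖ ∧ ‖x‖ < 5 * R} ∪ {x | 5 * R ≤ ‖x‖} := by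
    intro x (hx : R ≤ ‖x‖)
    rcases lt_or_ge ‖x‖ (5 * R) with h | h
    · exact Or.inl ⟨hx, h⟩
    · exact Or.inr h
  have h2 := (measureReal_mono (μ := ν) hsub).trans (measureReal_union_le _ _)
  rw [hδ] at h2
  have h3 : 7 / 10 * 1 * (δ / (7 / 10)) ^ 3 ≤ δ / 2 := by
    have e3 : 7 / 10 * 1 * (δ / (7 / 10)) ^ 3 = δ * (δ * δ) * (100 / 49) := by ring
    have : δ * δ ≤ 1 / 4 * (1 / 4) := by gcongr
    rw [e3]
    nlinarith [mul_le_mul_of_nonneg_left this hδ0.le]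
  linarith

section NormTail

variable {E : Type*} [NormedAddCommGroup E] [InnerProductSpace ℝ E] [FiniteDimensional ℝ E]
  [MeasurableSpace E] [BorelSpace E]

lemma stdGaussian_evenMoment_lt {κ : Measure E} [IsFiniteMeasure κ] {m : ℕ} (hm : 1 ≤ m)
    (hκ : rexp (-m) / 2 ≤ κ.real Set.univ) {σ R : ℝ} (hσ0 : 0 < σ) (hR : 400 * σ ≤ R)
    (hb : ∀ᵐ x ∂κ, R ≤ ‖x‖ ∧ ‖x‖ ≤ 5 * R)
    (hσ : ∀ z, evenMoment κ m z ≤ (σ * ‖z‖) ^ (2 * m)) :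
    (stdGaussian E).real {y | evenMoment κ m y < (√m * R / 128) ^ (2 * m)} ≤ 1 / 8 := by
  have hm' : (1 : ℝ) ≤ m := by exact_mod_cast hm
  have hR0 : 0 < R := by linarith
  have hs : √(m : ℝ) ^ 2 = m := Real.sq_sqrt (by positivity)
  have hb1 : ∀ᵐ x ∂κ, R ≤ ‖x‖ := hb.mono fun _ h => h.1
  have hb2 : ∀ᵐ x ∂κ, ‖x‖ ≤ 5 * R := hb.mono fun _ h => h.2
  set T := κ.real Set.univ with hT
  have hT0 : 0 < T := lt_of_lt_of_le (by positivity) hκ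
  set M := √m * R / 16 with hM
  have hM0 : 0 < M := by positivity
  have h1 := le_measureReal_le_slice (γ := stdGaussian E) (κ := κ)
    (measurableSet_le_inner (√m * R)) (exp_pos (-(3 * (m : ℝ)))).le hT0 hT.symm
    (hb1.mono fun x hx => exp_neg_le_stdGaussian_inner x hm hR0 hx)
  have hu0 : 0 < (√m * R) ^ (2 * m) := by positivity
  have hsub : {y : E | T * rexp (-(3 * (m : ℝ))) / 2 ≤ κ.real {x | √m * R ≤ ⟪y, x⟫}} ⊆
      {y | M ^ (2 * m) ≤ evenMoment κ m y} := by
    intro y hy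
    rw [Set.mem_ofPred_eq] at hy
    show M ^ (2 * m) ≤ evenMoment κ m y
    set B : Set E := {x | √m * R ≤ ⟪y, x⟫} with hB
    have hBm : MeasurableSet B := (isClosed_le continuous_const (by fun_prop)).measurableSet
    have h2 : (√m * R) ^ (2 * m) * κ.real B ≤ evenMoment κ m y := by
      have : ∫ x, B.indicator (fun _ => (√m * R) ^ (2 * m)) x ∂κ ≤ evenMoment κ m y := by
        refine integral_mono ((integrable_const _).indicator hBm)
          (integrable_of_continuous_of_ae_norm_le hb2 (by fun_prop)) fun x => ?_
        by_cases hx : x ∈ B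
        · rw [Set.indicator_of_mem hx]
          exact pow_le_pow_left₀ (by positivity) hx _
        · rw [Set.indicator_of_notMem hx]
          exact (even_two_mul m).pow_nonneg _
      rw [integral_indicator_const _ hBm, smul_eq_mul, mul_comm] at this
      exact this
    refine le_trans ?_ h2
    have h3 : rexp (-(4 * m)) / 4 ≤ κ.real B := by
      refine le_trans ?_ hy
      have : rexp (-(4 * m : ℝ)) = rexp (-m) * rexp (-(3 * (m : ℝ))) := by
        rw [← exp_add]; congr 1; ring
      rw [this]
      have := mul_le_mul_of_nonneg_right hκ (exp_pos (-(3 * (m : ℝ)))).le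
      linarith
    have h4 : (1 / 16 : ℝ) ^ (2 * m) ≤ rexp (-(4 * m)) / 4 := by
      have e1 : rexp (-(4 * m : ℝ)) = rexp (-4) ^ m := by rw [← exp_nat_mul]; congr 1; ring
      have e2 : (1 / 64 : ℝ) ≤ rexp (-4) := by
        have : rexp (-4 : ℝ) = rexp (-1) ^ 4 := by rw [← exp_nat_mul]; norm_num
        rw [this]
        have h5 : (0.36 : ℝ) ≤ rexp (-1) := by have := Real.exp_neg_one_gt_d9; linarith
        calc (1 / 64 : ℝ) ≤ 0.36 ^ 4 := by norm_num
          _ ≤ _ := by gcongr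
      rw [e1, le_div_iff₀ (by norm_num), pow_mul]
      calc ((1 / 16 : ℝ) ^ 2) ^ m * 4 ≤ ((1 / 16 : ℝ) ^ 2) ^ m * (4 ^ m) := by
            gcongr
            calc (4 : ℝ) = 4 ^ 1 := by norm_num
              _ ≤ 4 ^ m := pow_le_pow_right₀ (by norm_num) hm
        _ = (1 / 64) ^ m := by rw [← mul_pow]; norm_num
        _ ≤ rexp (-4) ^ m := by gcongr
    calc M ^ (2 * m) = (√m * R) ^ (2 * m) * (1 / 16) ^ (2 * m) := by
          rw [← mul_pow, hM]; congr 1; ring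
      _ ≤ _ := by gcongr; exact h4.trans h3
  have h5 := h1.trans (measureReal_mono hsub)
  have h6 := stdGaussian_evenMoment_dichotomy hb2 hm hσ0 hM0 hσ
  have eM : M / 8 = √m * R / 128 := by rw [hM]; ring
  rw [eM] at h6
  set P := (stdGaussian E).real {y | evenMoment κ m y < (√m * R / 128) ^ (2 * m)}
  have hP : 0 ≤ P := measureReal_nonneg
  have h7 : rexp (-(3 * (m : ℝ))) / 2 * P ≤ 2 * rexp (-((M / (3 * σ)) ^ 2 / 8)) :=
    (mul_le_mul_of_nonneg_right h5 hP).trans h6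
  have h8 : rexp (-((M / (3 * σ)) ^ 2 / 8)) ≤ rexp (-(3 * (m : ℝ))) * (1 / 32) := by
    have e1 : 7 * (m : ℝ) ≤ (M / (3 * σ)) ^ 2 / 8 := by
      have : (M / (3 * σ)) ^ 2 / 8 = m * (R ^ 2 / (18432 * σ ^ 2)) := by
        rw [hM, div_pow, div_pow, mul_pow, hs]; field_simp; norm_num
      rw [this, mul_comm]
      gcongr
      rw [le_div_iff₀ (by positivity)]
      have := pow_le_pow_left₀ (by positivity) hR 2
      nlinarith [sq_nonneg σ]
    have e2 : rexp (-4) ≤ 1 / 32 := by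
      have h1 : rexp (-4 : ℝ) = rexp (-1) ^ 4 := by rw [← exp_nat_mul]; norm_num
      have h2 := Real.exp_neg_one_lt_d9
      rw [h1]
      calc rexp (-1) ^ 4 ≤ (0.38 : ℝ) ^ 4 := by gcongr; linarith
        _ ≤ _ := by norm_num
    calc rexp (-((M / (3 * σ)) ^ 2 / 8)) ≤ rexp (-(3 * (m : ℝ)) + -4) := by
          apply exp_le_exp.2; linarith
      _ = rexp (-(3 * (m : ℝ))) * rexp (-4) := exp_add _ _
      _ ≤ _ := by gcongr
  have h9 := exp_pos (-(3 * (m : ℝ)))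
  have h10 : rexp (-(3 * (m : ℝ))) * P ≤ rexp (-(3 * (m : ℝ))) * (1 / 8) := by linarith
  exact le_of_mul_le_mul_left h10 h9

lemma exp_neg_le_moment_ratio {m : ℕ} (hm : 1 ≤ m) {R : ℝ} (hR : 0 < R) :
    rexp (-(40 * m)) ≤ (√m * R / 256) ^ (4 * m) /
      (4 * (8 * (12 * ((2 * m : ℕ) : ℝ) * (5 * R) ^ 2) ^ (2 * m))) := by
  have hm' : (1 : ℝ) ≤ m := by exact_mod_cast hm
  have hs : √(m : ℝ) ^ 2 = m := Real.sq_sqrt (by positivity)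
  have e1 : (√m * R / 256) ^ (4 * m) = (m * R ^ 2 / 65536) ^ (2 * m) := by
    rw [show 4 * m = 2 * (2 * m) by ring, pow_mul _ 2 (2 * m), div_pow, mul_pow, hs]
    norm_num
  have e2 : (12 * ((2 * m : ℕ) : ℝ) * (5 * R) ^ 2) = (m * R ^ 2 / 65536) * (600 * 65536) := by
    push_cast; ring
  have hpos : 0 < (m * R ^ 2 / 65536 : ℝ) := by positivity
  rw [e1, e2, mul_pow, le_div_iff₀ (by positivity)]
  have e3 : rexp (-(40 * m : ℝ)) = rexp (-20) ^ (2 * m) := by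
    rw [← exp_nat_mul]; congr 1; push_cast; ring
  have e4 : rexp (-20 : ℝ) * (600 * 65536) ≤ 1 / 6 := by
    have h1 : rexp (-20 : ℝ) = rexp (-1) ^ 20 := by rw [← exp_nat_mul]; norm_num
    have h2 := Real.exp_neg_one_lt_d9
    rw [h1]
    calc rexp (-1) ^ 20 * (600 * 65536) ≤ (0.368 : ℝ) ^ 20 * (600 * 65536) := by
          gcongr; linarith
      _ ≤ _ := by norm_num
  calc rexp (-(40 * m)) * (4 * (8 * ((m * R ^ 2 / 65536) ^ (2 * m) * (600 * 65536) ^ (2 * m))))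
      = 32 * (rexp (-20 : ℝ) * (600 * 65536)) ^ (2 * m) * (m * R ^ 2 / 65536) ^ (2 * m) := by
        rw [e3, mul_pow (rexp (-20))]; ring
    _ ≤ 32 * (1 / 6) ^ (2 * m) * (m * R ^ 2 / 65536) ^ (2 * m) := by gcongr
    _ ≤ 1 * (m * R ^ 2 / 65536) ^ (2 * m) := by
        gcongr
        rw [pow_mul]
        calc 32 * ((1 / 6 : ℝ) ^ 2) ^ m ≤ 32 * ((1 / 6 : ℝ) ^ 2) ^ 1 := by
              gcongr 32 * ?_
              exact pow_le_pow_of_le_one (by norm_num) (by norm_num) hm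
          _ ≤ 1 := by norm_num
    _ = _ := one_mul _

lemma LogConcaveMeasure.interpolate {ν : Measure E} [IsFiniteMeasure ν] (h : LogConcaveMeasure ν)
    {ρ R τ u v : ℝ} (hρ : 0 < ρ) (hR : ρ < R) (hu : u ≤ ρ / R * τ - 8 * ρ) {y : E}
    (h1 : 1 / 2 * rexp (-v) ≤ ν.real {x | (R ≤ ‖x‖ ∧ ‖x‖ < 5 * R) ∧ τ ≤ ⟪y, x⟫})
    (h2 : 1 / 2 ≤ ν.real {x | ‖x‖ < ρ ∧ |⟪y, x⟫| < 8 * ρ}) :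
    1 / 2 * rexp (-(v * (ρ / R))) ≤ ν.real {x | ‖x‖ ≤ 6 * ρ ∧ u ≤ ⟪y, x⟫} := by
  have hR0 : 0 < R := hρ.trans hR
  set a := ρ / R with ha
  have ha0 : 0 < a := by positivity
  have ha1 : a < 1 := by rw [ha, div_lt_one hR0]; exact hR
  have hi : Measurable fun x : E => (⟪y, x⟫ : ℝ) := by fun_prop
  have m1 : MeasurableSet {x : E | (R ≤ ‖x‖ ∧ ‖x‖ < 5 * R) ∧ τ ≤ ⟪y, x⟫} :=
    ((measurableSet_le measurable_const measurable_norm).inter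
      (measurableSet_lt measurable_norm measurable_const)).inter
      (measurableSet_le measurable_const hi)
  have m2 : MeasurableSet {x : E | ‖x‖ < ρ ∧ |⟪y, x⟫| < 8 * ρ} :=
    (measurableSet_lt measurable_norm measurable_const).inter
      (measurableSet_lt (hi.abs) measurable_const)
  have m3 : MeasurableSet {x : E | ‖x‖ ≤ 6 * ρ ∧ u ≤ ⟪y, x⟫} :=
    (measurableSet_le measurable_norm measurable_const).inter
      (measurableSet_le measurable_const hi)
  have h3 := h _ _ _ m1 m2 m3 a ha0 ha1 (by
    rintro x ⟨⟨hx1, hx2⟩, hx3⟩ z ⟨hz1, hz2⟩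
    constructor
    · refine (norm_add_le _ _).trans ?_
      rw [norm_smul, norm_smul, norm_of_nonneg ha0.le, norm_of_nonneg (by linarith)]
      have e1 : a * ‖x‖ ≤ a * (5 * R) := by gcongr
      have e2 : a * (5 * R) = 5 * ρ := by rw [ha]; field_simp
      have e3 : (1 - a) * ‖z‖ ≤ 1 * ρ := by gcongr; linarith
      linarith
    · rw [inner_add_right, inner_smul_right, inner_smul_right]
      have e1 : a * τ ≤ a * ⟪y, x⟫ := by gcongr
      have e2 : -(8 * ρ) ≤ (1 - a) * ⟪y, z⟫ := by
        have := (abs_lt.1 hz2).1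
        nlinarith
      linarith)
  refine le_trans ?_ h3
  have ha2 : 0 ≤ 1 - a := by linarith
  have e : (1 / 2 : ℝ) ^ a * (1 / 2) ^ (1 - a) = 1 / 2 := by
    rw [← rpow_add (by norm_num)]; simp
  calc 1 / 2 * rexp (-(v * a)) = (1 / 2 * rexp (-v)) ^ a * (1 / 2) ^ (1 - a) := by
        rw [mul_rpow (by norm_num) (exp_pos _).le, ← exp_mul, ← neg_mul]
        linear_combination (-rexp (-v * a)) * e
    _ ≤ _ := by gcongr

end NormTail

section NormTail

variable {E : Type*} [NormedAddCommGroup E] [InnerProductSpace ℝ E] [FiniteDimensional ℝ E]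
  [MeasurableSpace E] [BorelSpace E]

lemma stdGaussian_bulk_le {ν : Measure E} [IsProbabilityMeasure ν] {ρ : ℝ} (hρ : 0 < ρ) :
    (stdGaussian E).real {y | 1 / 4 ≤ ν.real {x | ‖x‖ < ρ ∧ 8 * ρ ≤ |⟪y, x⟫|}} ≤ 1 / 16 := by
  have hS : MeasurableSet {q : E × E | ‖q.2‖ < ρ ∧ 8 * ρ ≤ |⟪q.1, q.2⟫|} := by
    have h1 : Measurable fun q : E × E => ‖q.2‖ := by fun_prop
    have h2 : Measurable fun q : E × E => |(⟪q.1, q.2⟫ : ℝ)| :=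
      (show Continuous fun q : E × E => |(⟪q.1, q.2⟫ : ℝ)| by fun_prop).measurable
    exact (measurableSet_lt h1 measurable_const).inter (measurableSet_le measurable_const h2)
  have h := measureReal_le_slice_le (γ := stdGaussian E) (κ := ν) hS (δ := 1 / 64) (c := 1 / 4)
    (by norm_num) (by norm_num) (by simp) (fun x => by
      by_cases hx : ‖x‖ < ρ
      · have h1 := stdGaussian_inner_tail x hρ hx.le (u := 8 * ρ) (by positivity)
        have h2 := stdGaussian_inner_tail (-x) hρ (by rw [norm_neg]; exact hx.le) (u := 8 * ρ)
          (by positivity)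
        have e : (8 * ρ) ^ 2 / (2 * ρ ^ 2) = 32 := by field_simp; norm_num
        rw [e] at h1 h2
        have h3 : rexp (-32) ≤ 1 / 128 := by
          rw [exp_neg, inv_le_comm₀ (exp_pos _) (by norm_num)]
          have := Real.quadratic_le_exp_of_nonneg (show (0 : ℝ) ≤ 32 by norm_num)
          norm_num at this ⊢
          linarith
        have hsub : {y : E | (y, x) ∈ {q : E × E | ‖q.2‖ < ρ ∧ 8 * ρ ≤ |⟪q.1, q.2⟫|}} ⊆
            {y | 8 * ρ ≤ ⟪y, x⟫} ∪ {y | 8 * ρ ≤ ⟪y, -x⟫} := by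
          rintro y ⟨-, hy⟩
          rcases le_abs.1 hy with h | h
          · exact Or.inl h
          · right; rw [Set.mem_ofPred_eq, inner_neg_right]; exact h
        have := (measureReal_mono (μ := stdGaussian E) hsub).trans (measureReal_union_le _ _)
        linarith
      · have : {y : E | (y, x) ∈ {q : E × E | ‖q.2‖ < ρ ∧ 8 * ρ ≤ |⟪q.1, q.2⟫|}} = ∅ := by
          ext y; simp [hx]
        rw [this]; simp)
  norm_num at h
  exact h

lemma stdGaussian_inner_ge_le {ν : Measure E} [IsProbabilityMeasure ν] {ρ e : ℝ} (hρ : 0 < ρ)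
    (he : |e| = 1) (m : ℕ) :
    (stdGaussian E).real {y | 16 * rexp (-(m / 18874368)) ≤
      ν.real {x | ‖x‖ ≤ 6 * ρ ∧ √m * ρ / 512 ≤ ⟪e • y, x⟫}} ≤ 1 / 16 := by
  have hs : √(m : ℝ) ^ 2 = m := Real.sq_sqrt (by positivity)
  have hS : MeasurableSet {q : E × E | ‖q.2‖ ≤ 6 * ρ ∧ √m * ρ / 512 ≤ ⟪e • q.1, q.2⟫} := by
    have h1 : Measurable fun q : E × E => ‖q.2‖ := by fun_prop
    have h2 : Measurable fun q : E × E => (⟪e • q.1, q.2⟫ : ℝ) :=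
      (show Continuous fun q : E × E => (⟪e • q.1, q.2⟫ : ℝ) by fun_prop).measurable
    exact (measurableSet_le h1 measurable_const).inter (measurableSet_le measurable_const h2)
  have h := measureReal_le_slice_le (γ := stdGaussian E) (κ := ν) hS
    (δ := rexp (-(m / 18874368))) (c := 16 * rexp (-(m / 18874368)))
    (by positivity) (by positivity) (by simp) (fun x => by
      by_cases hx : ‖x‖ ≤ 6 * ρ
      · have h1 := stdGaussian_inner_tail (e • x) (r := 6 * ρ) (by positivity)
          (by rwa [norm_smul, Real.norm_eq_abs, he, one_mul]) (u := √m * ρ / 512) (by positivity)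
        have e : (√m * ρ / 512) ^ 2 / (2 * (6 * ρ) ^ 2) = m / 18874368 := by
          rw [div_pow, mul_pow, hs]; field_simp; ring
        rw [e] at h1
        refine (measureReal_mono ?_).trans h1
        rintro y ⟨-, hy⟩
        rw [Set.mem_ofPred_eq, inner_smul_right]
        simpa [inner_smul_left] using hy
      · have : {y : E | (y, x) ∈ {q : E × E | ‖q.2‖ ≤ 6 * ρ ∧
            √m * ρ / 512 ≤ ⟪e • q.1, q.2⟫}} = ∅ := by
          ext y; simp [hx]
        rw [this]; simp; positivity)
  refine h.trans (le_of_eq ?_)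
  field_simp

/-- A Paouris-type large deviation bound for the Euclidean norm of a log-concave vector. -/
lemma LogConcaveMeasure.norm_tail {ν : Measure E} [IsProbabilityMeasure ν]
    (h : LogConcaveMeasure ν) {m : ℕ} (hm : 200000000 ≤ m) {ρ σ R : ℝ} (hρ0 : 0 < ρ)
    (hσ0 : 0 < σ) (hρ : ν.real {x | ρ ≤ ‖x‖} ≤ 1 / 4)
    (hσ : ∀ y, ∫⁻ x, ENNReal.ofReal (⟪y, x⟫ ^ (2 * m)) ∂ν ≤
      ENNReal.ofReal ((σ * ‖y‖) ^ (2 * m)))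
    (hRρ : 2000000000 * ρ ≤ R) (hRσ : 400 * σ ≤ R) :
    ν.real {x | R ≤ ‖x‖} ≤ rexp (-m) := by
  by_contra! hcon
  have hm1 : 1 ≤ m := by omega
  have hm' : (200000000 : ℝ) ≤ m := by exact_mod_cast hm
  have hR0 : 0 < R := by linarith
  have hs : √(m : ℝ) ^ 2 = m := Real.sq_sqrt (by positivity)
  have hs0 : 8192 ≤ √(m : ℝ) := Real.le_sqrt_of_sq_le (by norm_num; linarith)
  set D : Set E := {x | R ≤ ‖x‖ ∧ ‖x‖ < 5 * R} with hD
  have hDm : MeasurableSet D := (measurableSet_le measurable_const measurable_norm).inter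
    (measurableSet_lt measurable_norm measurable_const)
  have hDle : rexp (-m) / 2 ≤ ν.real D := by
    have := h.le_measureReal_annulus (R := R) rfl ((exp_pos _).trans hcon)
      (le_trans (measureReal_mono fun x (hx : R ≤ ‖x‖) => (by linarith : ρ ≤ ‖x‖)) hρ)
    linarith
  set κ := ν.restrict D with hκ
  have hκu : κ.real Set.univ = ν.real D := by simp [hκ, measureReal_restrict_apply]
  have hκ1 : κ.real Set.univ ≤ 1 := by rw [hκu]; exact measureReal_le_one
  have hb : ∀ᵐ x ∂κ, R ≤ ‖x‖ ∧ ‖x‖ ≤ 5 * R := by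
    filter_upwards [ae_restrict_mem hDm] with x hx
    exact ⟨hx.1, hx.2.le⟩
  have hb2 : ∀ᵐ x ∂κ, ‖x‖ ≤ 5 * R := hb.mono fun _ h => h.2
  have hσ' : ∀ z, evenMoment κ m z ≤ (σ * ‖z‖) ^ (2 * m) := by
    intro z
    rw [← ENNReal.ofReal_le_ofReal_iff (by positivity), evenMoment,
      ofReal_integral_eq_lintegral_ofReal
        (integrable_of_continuous_of_ae_norm_le hb2 (by fun_prop))
        (ae_of_all _ fun x => (even_two_mul m).pow_nonneg _)]
    exact (lintegral_mono' Measure.restrict_le_self le_rfl).trans (hσ z)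
  have b1 := stdGaussian_evenMoment_lt hm1 (by rwa [hκu]) hσ0 hRσ hb hσ'
  have b2 := stdGaussian_le_evenMoment hκ1 (by positivity) hb2 (k := 2 * m) (by omega)
  have b3 := stdGaussian_bulk_le (ν := ν) hρ0
  have b4 := stdGaussian_inner_ge_le (ν := ν) hρ0 (e := 1) (by simp) m
  have b5 := stdGaussian_inner_ge_le (ν := ν) hρ0 (e := -1) (by simp) m
  set B1 := {y : E | evenMoment κ m y < (√m * R / 128) ^ (2 * m)}
  set B2 := {y : E | 8 * (12 * ((2 * m : ℕ) : ℝ) * (5 * R) ^ 2) ^ (2 * m) ≤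
    evenMoment κ (2 * m) y}
  set B3 := {y : E | 1 / 4 ≤ ν.real {x | ‖x‖ < ρ ∧ 8 * ρ ≤ |⟪y, x⟫|}}
  set B4 := {y : E | 16 * rexp (-(m / 18874368)) ≤
      ν.real {x | ‖x‖ ≤ 6 * ρ ∧ √m * ρ / 512 ≤ ⟪(1 : ℝ) • y, x⟫}}
  set B5 := {y : E | 16 * rexp (-(m / 18874368)) ≤
      ν.real {x | ‖x‖ ≤ 6 * ρ ∧ √m * ρ / 512 ≤ ⟪(-1 : ℝ) • y, x⟫}}
  obtain ⟨y, hy⟩ : ∃ y, y ∉ B1 ∪ (B2 ∪ (B3 ∪ (B4 ∪ B5))) := by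
    by_contra! hall
    have hu : B1 ∪ (B2 ∪ (B3 ∪ (B4 ∪ B5))) = Set.univ := Set.eq_univ_of_forall hall
    have u1 := measureReal_union_le (μ := stdGaussian E) B1 (B2 ∪ (B3 ∪ (B4 ∪ B5)))
    have u2 := measureReal_union_le (μ := stdGaussian E) B2 (B3 ∪ (B4 ∪ B5))
    have u3 := measureReal_union_le (μ := stdGaussian E) B3 (B4 ∪ B5)
    have u4 := measureReal_union_le (μ := stdGaussian E) B4 B5
    rw [hu, probReal_univ] at u1
    linarith
  simp only [Set.mem_union, not_or, B1, B2, B3, B4, B5, Set.mem_ofPred_eq, not_lt, not_le] at hy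
  obtain ⟨y1, y2, y3, y4, y5⟩ := hy
  set τ := √m * R / 256 with hτ
  have hτ0 : 0 < τ := by positivity
  have p1 := le_measureReal_le_abs_inner hκ1 hb2 hm1 hτ0 (by positivity)
    (by rwa [hτ, show 2 * (√m * R / 256) = √m * R / 128 by ring]) y2.le
  replace p1 := (exp_neg_le_moment_ratio hm1 hR0).trans p1
  have hi : Measurable fun x : E => |(⟪y, x⟫ : ℝ)| := by fun_prop
  rw [hκ, measureReal_restrict_apply (measurableSet_le measurable_const hi)] at p1
  have hsub : {x : E | τ ≤ |⟪y, x⟫|} ∩ D ⊆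
      {x | (R ≤ ‖x‖ ∧ ‖x‖ < 5 * R) ∧ τ ≤ ⟪(1 : ℝ) • y, x⟫} ∪
      {x | (R ≤ ‖x‖ ∧ ‖x‖ < 5 * R) ∧ τ ≤ ⟪(-1 : ℝ) • y, x⟫} := by
    rintro x ⟨hx, hxD⟩
    rw [Set.mem_ofPred_eq] at hx
    rcases le_abs.1 hx with h | h
    · left; exact ⟨hxD, by simpa using h⟩
    · right; exact ⟨hxD, by simpa using h⟩
  have p2 := p1.trans ((measureReal_mono hsub).trans (measureReal_union_le _ _))
  have bulk : ∀ e : ℝ, |e| = 1 →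
      1 / 2 ≤ ν.real {x | ‖x‖ < ρ ∧ |⟪e • y, x⟫| < 8 * ρ} := by
    intro e he
    have hcov : Set.univ ⊆ {x : E | ρ ≤ ‖x‖} ∪ ({x | ‖x‖ < ρ ∧ 8 * ρ ≤ |⟪y, x⟫|} ∪
        {x | ‖x‖ < ρ ∧ |⟪e • y, x⟫| < 8 * ρ}) := by
      intro x _
      simp only [Set.mem_union, Set.mem_ofPred_eq, inner_smul_left, abs_mul]
      simp only [conj_trivial, he, one_mul]
      rcases le_or_gt ρ ‖x‖ with h | h
      · exact Or.inl h
      · rcases le_or_gt (8 * ρ) |(⟪y, x⟫ : ℝ)| with h' | h'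
        · exact Or.inr (Or.inl ⟨h, h'⟩)
        · exact Or.inr (Or.inr ⟨h, h'⟩)
    have h1 := measureReal_mono (μ := ν) hcov
    have h2 := measureReal_union_le (μ := ν) {x : E | ρ ≤ ‖x‖}
      ({x | ‖x‖ < ρ ∧ 8 * ρ ≤ |⟪y, x⟫|} ∪ {x | ‖x‖ < ρ ∧ |⟪e • y, x⟫| < 8 * ρ})
    have h3 := measureReal_union_le (μ := ν) {x : E | ‖x‖ < ρ ∧ 8 * ρ ≤ |⟪y, x⟫|}
      {x | ‖x‖ < ρ ∧ |⟪e • y, x⟫| < 8 * ρ}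
    rw [probReal_univ] at h1
    linarith
  have hu : √m * ρ / 512 ≤ ρ / R * τ - 8 * ρ := by
    have : ρ / R * τ = √m * ρ / 256 := by rw [hτ]; field_simp
    rw [this]
    nlinarith
  have hexp : 16 * rexp (-(m / 18874368)) ≤ 1 / 2 * rexp (-(40 * m * (ρ / R))) := by
    have h1 : ρ / R ≤ 1 / 2000000000 := by
      rw [div_le_div_iff₀ hR0 (by norm_num)]; linarith
    have h2 : 40 * m * (ρ / R) ≤ 40 * m * (1 / 2000000000) := by gcongr
    have h3 : rexp (-(m / 18874368)) ≤ rexp (-5 + -(40 * m * (ρ / R))) := by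
      apply exp_le_exp.2
      linarith
    rw [exp_add] at h3
    have h4 : rexp (-5 : ℝ) ≤ 1 / 32 := by
      have h1 : rexp (-5 : ℝ) = rexp (-1) ^ 5 := by rw [← exp_nat_mul]; norm_num
      have h2 := Real.exp_neg_one_lt_d9
      rw [h1]
      calc rexp (-1) ^ 5 ≤ (0.4 : ℝ) ^ 5 := by gcongr; linarith
        _ ≤ _ := by norm_num
    have := mul_le_mul_of_nonneg_right h4 (exp_pos (-(40 * m * (ρ / R)))).le
    linarith
  have hsign : ∀ e : ℝ, |e| = 1 → ν.real {x | ‖x‖ ≤ 6 * ρ ∧ √m * ρ / 512 ≤ ⟪e • y, x⟫} <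
      16 * rexp (-(m / 18874368)) →
      ν.real {x | (R ≤ ‖x‖ ∧ ‖x‖ < 5 * R) ∧ τ ≤ ⟪e • y, x⟫} < 1 / 2 * rexp (-(40 * m)) := by
    intro e he hlt
    by_contra! hge
    have := h.interpolate hρ0 (by linarith) hu hge (bulk e he)
    linarith
  have q1 := hsign 1 (by simp) y4
  have q2 := hsign (-1) (by simp) y5
  linarith

end NormTail

section Moments

lemma rpow_mul_measureReal_le_of_lintegral {Z : Type*} [MeasurableSpace Z] {κ : Measure Z}
    [IsFiniteMeasure κ] {g : Z → ℝ} (hg : Measurable g) {q r M : ℝ}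
    (hq : 0 < q) (hr : 0 < r) (hM : 0 ≤ M)
    (h : ∫⁻ x, ENNReal.ofReal (g x ^ q) ∂κ ≤ ENNReal.ofReal M) :
    r ^ q * κ.real {x | r ≤ g x} ≤ M := by
  have h2 := mul_meas_ge_le_lintegral (μ := κ) (hg.pow_const q).ennreal_ofReal
    (ENNReal.ofReal (r ^ q))
  have hsub : {x | r ≤ g x} ⊆ {x | ENNReal.ofReal (r ^ q) ≤ ENNReal.ofReal (g x ^ q)} :=
    fun x hx => ENNReal.ofReal_le_ofReal (rpow_le_rpow hr.le hx hq.le)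
  have h3 := (mul_le_mul_right (measure_mono (μ := κ) hsub) (ENNReal.ofReal (r ^ q))).trans
    (h2.trans h)
  rwa [← ofReal_measureReal, ← ENNReal.ofReal_mul (by positivity),
    ENNReal.ofReal_le_ofReal_iff hM] at h3

variable {E : Type*} [NormedAddCommGroup E] [InnerProductSpace ℝ E]
  [MeasurableSpace E] [BorelSpace E]

lemma four_rpow_neg_le {p : ℝ} (hp : 1 ≤ p) : (4 : ℝ) ^ (-p) ≤ 7 / 10 * rexp (-p) := by
  have h1 : (4 : ℝ) ^ (-p) = (rexp 1 / 4) ^ p * rexp (-p) := by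
    rw [rpow_neg (by norm_num), div_rpow (exp_pos _).le (by norm_num), exp_one_rpow, exp_neg]
    field_simp
  have he := Real.exp_one_lt_d9
  have h2 : (rexp 1 / 4) ^ p ≤ 7 / 10 := by
    calc (rexp 1 / 4) ^ p ≤ (rexp 1 / 4) ^ (1 : ℝ) :=
          rpow_le_rpow_of_exponent_ge (by positivity) (by linarith) hp
      _ ≤ 7 / 10 := by rw [rpow_one]; linarith
  rw [h1]
  gcongr

/-- Reverse Hölder inequality for linear functionals. -/
lemma LogConcaveMeasure.lintegral_inner_pow_le {ν : Measure E} [IsProbabilityMeasure ν]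
    (h : LogConcaveMeasure ν) {p s : ℝ} (hp : 1 ≤ p) (hs : 0 < s) {y : E}
    (hy : ∫⁻ x, ENNReal.ofReal (|⟪y, x⟫| ^ p) ∂ν ≤ ENNReal.ofReal ((s * ‖y‖) ^ p))
    {m : ℕ} (hm : p ≤ m) :
    ∫⁻ x, ENNReal.ofReal (⟪y, x⟫ ^ (2 * m)) ∂ν ≤
      ENNReal.ofReal ((96 * s * (m / p) * ‖y‖) ^ (2 * m)) := by
  have hm1 : 1 ≤ m := by exact_mod_cast hp.trans hm
  rcases eq_or_ne y 0 with rfl | hy0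
  · simp [show m ≠ 0 by omega]
  have hy0' : 0 < ‖y‖ := norm_pos_iff.2 hy0
  set r := 4 * (s * ‖y‖) with hr
  have hr0 : 0 < r := by positivity
  have hmk := rpow_mul_measureReal_le_of_lintegral (κ := ν) (g := fun x => |⟪y, x⟫|)
    (show Continuous fun x : E => |(⟪y, x⟫ : ℝ)| by fun_prop).measurable
    (by linarith) hr0 (by positivity) hy
  have hmk2 : ν.real {x | r ≤ ‖innerSL ℝ y x‖} ≤ 7 / 10 * rexp (-p) * ν.real Set.univ := by
    rw [probReal_univ, mul_one]
    refine le_trans ?_ (four_rpow_neg_le hp)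
    rw [hr, mul_rpow (by norm_num) (by positivity), mul_comm ((4 : ℝ) ^ p), mul_assoc] at hmk
    have h2 : 0 < (s * ‖y‖) ^ p := by positivity
    have h3 := (mul_le_iff_le_one_right h2).1 hmk
    rw [rpow_neg (by norm_num), ← one_div, le_div_iff₀ (by positivity), mul_comm]
    exact h3
  have hbor : ∀ t : ℝ, 1 ≤ t → ν.real {x | t * r ≤ ‖innerSL ℝ y x‖} ≤ 1 * rexp (-(p / 2 * t)) := by
    intro t ht
    refine (h.borell (innerSL ℝ y) hp hmk2 ht).trans ?_
    rw [probReal_univ]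
    have : rexp (-(p * ((t + 1) / 2))) ≤ rexp (-(p / 2 * t)) := by
      apply exp_le_exp.2; linarith
    have := exp_pos (-(p / 2 * t))
    linarith
  have hmom := lintegral_norm_pow_le (innerSL ℝ y) hr0 (by linarith : 1 / 2 ≤ p / 2)
    (by simp) hbor (2 * m)
  have e : ∀ x : E, ‖innerSL ℝ y x‖ ^ (2 * m) = ⟪y, x⟫ ^ (2 * m) := fun x => by
    rw [innerSL_apply_apply, Real.norm_eq_abs, (even_two_mul m).pow_abs]
  simp only [e] at hmom
  refine hmom.trans (ENNReal.ofReal_le_ofReal ?_)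
  have h5 : 5 * rexp (p / 2 / 2) ≤ 3 ^ (2 * m) := by
    have h6 : rexp (p / 2 / 2) ≤ rexp (1 / 4) ^ m := by
      rw [← exp_nat_mul]; apply exp_le_exp.2; linarith
    have h7 : rexp (1 / 4) ≤ 9 / 5 := by
      have h8 : rexp (1 / 4 : ℝ) ≤ rexp (1 / 2) := by gcongr; norm_num
      have h9 : rexp (1 / 2 : ℝ) ^ 2 = rexp 1 := by rw [← exp_nat_mul]; norm_num
      have h10 := Real.exp_one_lt_d9
      nlinarith [exp_pos (1 / 2 : ℝ)]
    calc 5 * rexp (p / 2 / 2) ≤ 5 ^ m * (9 / 5) ^ m := by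
          gcongr
          · calc (5 : ℝ) = 5 ^ 1 := by norm_num
              _ ≤ 5 ^ m := pow_le_pow_right₀ (by norm_num) hm1
          · exact h6.trans (by gcongr)
      _ = 3 ^ (2 * m) := by rw [← mul_pow, pow_mul]; norm_num
  calc 5 * rexp (p / 2 / 2) * (2 * r * ((2 * m : ℕ) : ℝ) / (p / 2)) ^ (2 * m) * 1
      ≤ 3 ^ (2 * m) * (2 * r * ((2 * m : ℕ) : ℝ) / (p / 2)) ^ (2 * m) := by
        rw [mul_one]; gcongr
    _ = _ := by
        rw [← mul_pow]; congr 1; rw [hr]; push_cast; field_simp; norm_num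

end Moments

section Coordinates

variable {n : ℕ}

/-- The coordinate projection of `ℝⁿ` onto the coordinates in `I`. -/
def coordProj (I : Finset (Fin n)) :
    EuclideanSpace ℝ (Fin n) →L[ℝ] EuclideanSpace ℝ (Fin n) :=
  LinearMap.toContinuousLinearMap
    { toFun := fun x => WithLp.toLp 2 fun i => if i ∈ I then x i else 0
      map_add' := fun x y => by
        ext i
        by_cases h : i ∈ I <;> simp [h]
      map_smul' := fun c x => by
        ext i
        by_cases h : i ∈ I <;> simp [h] }

lemma coordProj_apply (I : Finset (Fin n)) (x : EuclideanSpace ℝ (Fin n)) (i : Fin n) :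
    coordProj I x i = if i ∈ I then x i else 0 := rfl

lemma norm_sq_coordProj (I : Finset (Fin n)) (x : EuclideanSpace ℝ (Fin n)) :
    ‖coordProj I x‖ ^ 2 = ∑ i ∈ I, x i ^ 2 := by
  rw [EuclideanSpace.real_norm_sq_eq]
  simp only [coordProj_apply, ite_pow]
  simp

lemma norm_coordProj_le (I : Finset (Fin n)) (x : EuclideanSpace ℝ (Fin n)) :
    ‖coordProj I x‖ ≤ ‖x‖ := by
  rw [← sq_le_sq₀ (norm_nonneg _) (norm_nonneg _), norm_sq_coordProj,
    EuclideanSpace.real_norm_sq_eq]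
  exact Finset.sum_le_univ_sum_of_nonneg fun i => sq_nonneg _

lemma inner_coordProj (I : Finset (Fin n)) (x y : EuclideanSpace ℝ (Fin n)) :
    ⟪y, coordProj I x⟫ = ⟪coordProj I y, x⟫ := by
  simp only [PiLp.inner_apply, coordProj_apply]
  refine Finset.sum_congr rfl fun i _ => ?_
  by_cases h : i ∈ I <;> simp [h]

lemma lintegral_norm_sq_coordProj_le {ν : Measure (EuclideanSpace ℝ (Fin n))}
    (h2 : ∀ i, ∫⁻ x, ENNReal.ofReal (x i ^ 2) ∂ν ≤ 1) (I : Finset (Fin n)) :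
    ∫⁻ x, ENNReal.ofReal (‖coordProj I x‖ ^ (2 : ℝ)) ∂ν ≤ ENNReal.ofReal I.card := by
  have e : ∀ x : EuclideanSpace ℝ (Fin n), ENNReal.ofReal (‖coordProj I x‖ ^ (2 : ℝ)) =
      ∑ i ∈ I, ENNReal.ofReal (x i ^ 2) := fun x => by
    rw [rpow_two, norm_sq_coordProj, ENNReal.ofReal_sum_of_nonneg fun i _ => sq_nonneg _]
  simp only [e]
  rw [lintegral_finsetSum _ fun i _ => by fun_prop]
  refine (Finset.sum_le_sum fun i _ => h2 i).trans ?_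
  simp

end Coordinates

section CoordinateMoments

variable {n : ℕ} {ν : Measure (EuclideanSpace ℝ (Fin n))} [IsProbabilityMeasure ν]

lemma exp_quarter_le : rexp (1 / 2 / 2) ≤ 9 / 5 := by
  have h8 : rexp (1 / 2 / 2 : ℝ) ≤ rexp (1 / 2) := by gcongr; norm_num
  have h9 : rexp (1 / 2 : ℝ) ^ 2 = rexp 1 := by rw [← exp_nat_mul]; norm_num
  have h10 := Real.exp_one_lt_d9
  nlinarith [exp_pos (1 / 2 : ℝ)]

/-- The second moments of a coordinate projection on a convex set of small measure. -/
lemma LogConcaveMeasure.setLIntegral_norm_sq_coordProj_le (h : LogConcaveMeasure ν)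
    (h2 : ∀ i, ∫⁻ x, ENNReal.ofReal (x i ^ 2) ∂ν ≤ 1) {p s : ℝ} (hp : 1 ≤ p) (hs : 0 < s)
    (hmom : ∀ y, ∫⁻ x, ENNReal.ofReal (|⟪y, x⟫| ^ p) ∂ν ≤ ENNReal.ofReal ((s * ‖y‖) ^ p))
    {B : Set (EuclideanSpace ℝ (Fin n))} (hB : MeasurableSet B) (hc : Convex ℝ B) {v : ℝ}
    (hv : 0 ≤ v) (hBv : ν.real B = rexp (-v)) (I : Finset (Fin n)) :
    ∫⁻ x in B, ENNReal.ofReal (‖coordProj I x‖ ^ 2) ∂ν ≤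
      ENNReal.ofReal (10 ^ 30 * (I.card + ((1 + v / p) * s) ^ 2) * ν.real B) := by
  rcases I.eq_empty_or_nonempty with rfl | hI
  · simp [norm_sq_coordProj]
  have hN : (1 : ℝ) ≤ I.card := by exact_mod_cast hI.card_pos
  set N : ℝ := (I.card : ℝ) with hNdef
  have hp0 : 0 < p := by linarith
  have hvp : 0 ≤ v / p := by positivity
  set τ := (1 + v / p) * s with hτ
  have hτ0 : 0 < τ := by positivity
  obtain ⟨m, hm1, hm2, hm3⟩ : ∃ m : ℕ, 200000000 ≤ m ∧ v + p + 2 ≤ m ∧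
      (m : ℝ) ≤ v + p + 200000001 := by
    refine ⟨⌈v + p⌉₊ + 200000000, by omega, ?_, ?_⟩
    · have := Nat.le_ceil (v + p)
      push_cast; linarith
    · have := (Nat.ceil_lt_add_one (by positivity : 0 ≤ v + p)).le
      push_cast; linarith
  have hmp : (m : ℝ) / p ≤ 300000000 * (1 + v / p) := by
    rw [div_le_iff₀ hp0]
    have : 300000000 * (1 + v / p) * p = 300000000 * (p + v) := by field_simp
    rw [this]; linarith
  set P := coordProj I with hP
  have hPm : Measurable P := P.continuous.measurable
  have : IsProbabilityMeasure (ν.map P) := Measure.isProbabilityMeasure_map hPm.aemeasurable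
  have hsq : 0 < √N := sqrt_pos.2 (by linarith)
  set R := 2 * 10 ^ 13 * (√N + τ) with hR
  have hR0 : 0 < R := by positivity
  have htail : (ν.map P).real {x | R ≤ ‖x‖} ≤ rexp (-m) := by
    have hσpos : 0 < 96 * s * (m / p) := by
      have : (0 : ℝ) < m := by linarith
      positivity
    refine (h.map P).norm_tail hm1 (ρ := 2 * √N) (σ := 96 * s * (m / p)) (by positivity)
      hσpos ?_ ?_ ?_ ?_
    · rw [map_measureReal_apply hPm (measurableSet_le measurable_const measurable_norm)]
      have := rpow_mul_measureReal_le_of_lintegral (κ := ν) (g := fun x => ‖P x‖)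
        (hPm.norm) two_pos (by positivity : 0 < 2 * √N) (by positivity)
        (lintegral_norm_sq_coordProj_le h2 I)
      rw [rpow_two, mul_pow, sq_sqrt (by linarith), ← hNdef] at this
      change ν.real {x | 2 * √N ≤ ‖P x‖} ≤ 1 / 4
      nlinarith
    · intro y
      have hmeas : Measurable fun x : EuclideanSpace ℝ (Fin n) =>
          ENNReal.ofReal (⟪y, x⟫ ^ (2 * m)) := by fun_prop
      rw [lintegral_map hmeas hPm]
      simp only [hP, inner_coordProj]
      refine (h.lintegral_inner_pow_le hp hs (hmom (coordProj I y)) (by linarith)).trans ?_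
      gcongr
      exact norm_coordProj_le I y
    · rw [hR]; nlinarith
    · calc 400 * (96 * s * (m / p)) ≤ 400 * (96 * s * (300000000 * (1 + v / p))) := by gcongr
        _ = 11520000000000 * τ := by rw [hτ]; ring
        _ ≤ R := by rw [hR]; nlinarith
  rw [map_measureReal_apply hPm (measurableSet_le measurable_const measurable_norm)] at htail
  change ν.real {x | R ≤ ‖P x‖} ≤ _ at htail
  have hRB : (ν.restrict B).real {x | R ≤ ‖P x‖} ≤
      7 / 10 * rexp (-1) * (ν.restrict B).real Set.univ := by
    rw [measureReal_restrict_apply (measurableSet_le_norm_clm P R), measureReal_restrict_apply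
      MeasurableSet.univ, Set.univ_inter, hBv]
    refine (measureReal_mono Set.inter_subset_left).trans (htail.trans ?_)
    have e1 : rexp (-m) ≤ rexp (-1) * rexp (-1) * rexp (-v) := by
      rw [← exp_add, ← exp_add]; apply exp_le_exp.2; linarith
    have e2 : rexp (-1) ≤ 7 / 10 := by linarith [Real.exp_neg_one_lt_d9]
    refine e1.trans ?_
    gcongr
  have hbor : ∀ t : ℝ, 1 ≤ t → (ν.restrict B).real {x | t * R ≤ ‖P x‖} ≤
      ν.real B * rexp (-(1 / 2 * t)) := by
    intro t ht
    refine ((h.restrict hB hc).borell P le_rfl hRB ht).trans ?_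
    rw [measureReal_restrict_apply MeasurableSet.univ, Set.univ_inter]
    have e3 : rexp (-(1 * ((t + 1) / 2))) ≤ rexp (-(1 / 2 * t)) := by
      apply exp_le_exp.2; linarith
    have e4 : 7 / 10 * ν.real B ≤ ν.real B := by
      linarith [measureReal_nonneg (μ := ν) (s := B)]
    gcongr
  refine (lintegral_norm_pow_le P hR0 le_rfl (by
    rw [measureReal_restrict_apply MeasurableSet.univ, Set.univ_inter]) hbor 2).trans
    (ENNReal.ofReal_le_ofReal ?_)
  refine mul_le_mul_of_nonneg_right ?_ measureReal_nonneg
  have e5 : R ^ 2 ≤ 8 * 10 ^ 26 * (N + τ ^ 2) := by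
    have := sq_sqrt (by linarith : 0 ≤ N)
    rw [hR]; nlinarith [sq_nonneg (√N - τ)]
  calc 5 * rexp (1 / 2 / 2) * (2 * R * ((2 : ℕ) : ℝ) / (1 / 2)) ^ 2
      ≤ 5 * (9 / 5) * (2 * R * ((2 : ℕ) : ℝ) / (1 / 2)) ^ 2 := by gcongr; exact exp_quarter_le
    _ = 576 * R ^ 2 := by push_cast; ring
    _ ≤ _ := by linarith [sq_nonneg τ]

end CoordinateMoments

section DyadicSums

lemma sq_mul_exp_neg_le {x : ℝ} (hx : 0 ≤ x) :
    x ^ 2 * rexp (-x) ≤ 19 * (2 * x / (1 + 2 * x) - x / (1 + x)) := by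
  have h1 := Real.sum_le_exp_of_nonneg hx 4
  simp only [Finset.sum_range_succ, Finset.sum_range_zero, Nat.factorial] at h1
  norm_num at h1
  have h2 : 2 * x / (1 + 2 * x) - x / (1 + x) = x / ((1 + x) * (1 + 2 * x)) := by
    field_simp; ring
  rw [h2, exp_neg, ← div_eq_mul_inv, ← mul_div_assoc, div_le_div_iff₀ (exp_pos _) (by positivity)]
  have h3 : x * ((1 + x) * (1 + 2 * x)) ≤ 19 * rexp x := by
    nlinarith [pow_nonneg hx 2, pow_nonneg hx 3]
  nlinarith

lemma tsum_dyadic_sq_mul_exp_le {b T : ℝ} (hb : 0 < b) (hT : 0 < T) :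
    ∑' a : ℕ, ENNReal.ofReal ((2 ^ a * T) ^ 2 * rexp (-(2 * b * (2 ^ a * T)))) ≤
      ENNReal.ofReal (19 / b ^ 2 * rexp (-(b * T))) := by
  refine ENNReal.tsum_le_of_sum_range_le fun N => ?_
  rw [← ENNReal.ofReal_sum_of_nonneg fun a _ => by positivity]
  apply ENNReal.ofReal_le_ofReal
  have key : ∀ a : ℕ, (2 ^ a * T) ^ 2 * rexp (-(2 * b * (2 ^ a * T))) ≤
      19 / b ^ 2 * rexp (-(b * T)) * (b * (2 ^ (a + 1) * T) / (1 + b * (2 ^ (a + 1) * T)) -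
        b * (2 ^ a * T) / (1 + b * (2 ^ a * T))) := by
    intro a
    have h1 := sq_mul_exp_neg_le (by positivity : 0 ≤ b * (2 ^ a * T))
    have h2 : rexp (-(2 * b * (2 ^ a * T))) ≤ rexp (-(b * (2 ^ a * T))) * rexp (-(b * T)) := by
      rw [← exp_add]
      apply exp_le_exp.2
      have : (1 : ℝ) ≤ 2 ^ a := one_le_pow₀ (by norm_num)
      nlinarith [mul_pos hb hT]
    have h3 : 2 * (b * (2 ^ a * T)) = b * (2 ^ (a + 1) * T) := by ring
    rw [h3] at h1
    calc (2 ^ a * T) ^ 2 * rexp (-(2 * b * (2 ^ a * T)))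
        ≤ (2 ^ a * T) ^ 2 * (rexp (-(b * (2 ^ a * T))) * rexp (-(b * T))) := by gcongr
      _ = 1 / b ^ 2 * rexp (-(b * T)) *
          ((b * (2 ^ a * T)) ^ 2 * rexp (-(b * (2 ^ a * T)))) := by field_simp
      _ ≤ 1 / b ^ 2 * rexp (-(b * T)) * (19 * (b * (2 ^ (a + 1) * T) /
          (1 + b * (2 ^ (a + 1) * T)) - b * (2 ^ a * T) / (1 + b * (2 ^ a * T)))) := by gcongr
      _ = _ := by ring
  refine (Finset.sum_le_sum fun a _ => key a).trans ?_
  rw [← Finset.mul_sum, Finset.sum_range_sub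
    (fun a : ℕ => b * (2 ^ a * T) / (1 + b * (2 ^ a * T)))]
  refine mul_le_of_le_one_right (by positivity) ?_
  have h4 : b * (2 ^ N * T) / (1 + b * (2 ^ N * T)) ≤ 1 := by
    rw [div_le_one (by positivity)]; linarith
  have h5 : 0 ≤ b * (2 ^ 0 * T) / (1 + b * (2 ^ 0 * T)) := by positivity
  linarith

end DyadicSums

section CoordinateTails

variable {n : ℕ} {ν : Measure (EuclideanSpace ℝ (Fin n))}

lemma LogConcaveMeasure.measureReal_inter_le_abs_coord [IsFiniteMeasure ν]
    (h : LogConcaveMeasure ν)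
    {B : Set (EuclideanSpace ℝ (Fin n))} (hB : MeasurableSet B) (hc : Convex ℝ B) {i : Fin n}
    {A : ℝ} (hA : 0 < A)
    (hα : ∫⁻ x in B, ENNReal.ofReal (x i ^ 2) ∂ν ≤ ENNReal.ofReal (A ^ 2 * ν.real B)) (u : ℝ) :
    ν.real (B ∩ {x | u ≤ |x i|}) ≤ 2 * ν.real B * rexp (-(u / (4 * A))) := by
  have hi : Measurable fun x : EuclideanSpace ℝ (Fin n) => |x i| := by fun_prop
  have h1 := rpow_mul_measureReal_le_of_lintegral (κ := ν.restrict B)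
    (M := A ^ 2 * ν.real B) hi two_pos (by positivity : 0 < 2 * A) (by positivity)
    (by simpa only [rpow_two, sq_abs] using hα)
  have h2 := (h.restrict hB hc).borell'
    (EuclideanSpace.proj i : EuclideanSpace ℝ (Fin n) →L[ℝ] ℝ)
    (by positivity : 0 < 2 * A) (by
      rw [measureReal_restrict_apply MeasurableSet.univ, Set.univ_inter]
      change (ν.restrict B).real {x | 2 * A ≤ |x i|} ≤ _
      rw [rpow_two, mul_pow] at h1
      have : 0 < A ^ 2 := by positivity
      nlinarith) u
  change (ν.restrict B).real {x | u ≤ |x i|} ≤ _ at h2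
  rw [measureReal_restrict_apply MeasurableSet.univ, Set.univ_inter,
    measureReal_restrict_apply (measurableSet_le measurable_const hi), Set.inter_comm] at h2
  convert h2 using 4
  ring

lemma LogConcaveMeasure.tsum_sqrt_measure_inter_le [IsFiniteMeasure ν] (h : LogConcaveMeasure ν)
    {B : Set (EuclideanSpace ℝ (Fin n))} (hB : MeasurableSet B) (hc : Convex ℝ B) {i : Fin n}
    {A T : ℝ} (hA : 0 < A) (hT : 0 < T)
    (hα : ∫⁻ x in B, ENNReal.ofReal (x i ^ 2) ∂ν ≤ ENNReal.ofReal (A ^ 2 * ν.real B)) :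
    ∑' a : ℕ, ENNReal.ofReal ((2 ^ a * T) ^ 2) *
        ν (B ∩ {x | 2 ^ a * T ≤ |x i|}) ^ (1 / 2 : ℝ) ≤
      ENNReal.ofReal (7000 * A ^ 2 * rexp (-(T / (16 * A)))) * ν B ^ (1 / 2 : ℝ) := by
  have key : ∀ a : ℕ, ENNReal.ofReal ((2 ^ a * T) ^ 2) *
        ν (B ∩ {x | 2 ^ a * T ≤ |x i|}) ^ (1 / 2 : ℝ) ≤
      ENNReal.ofReal ((2 ^ a * T) ^ 2 * rexp (-(2 * (1 / (16 * A)) * (2 ^ a * T)))) *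
        (ENNReal.ofReal (√2) * ν B ^ (1 / 2 : ℝ)) := by
    intro a
    have h1 := h.measureReal_inter_le_abs_coord hB hc hA hα (2 ^ a * T)
    rw [← ofReal_measureReal (μ := ν) (s := B ∩ _), ← ofReal_measureReal (μ := ν) (s := B),
      ENNReal.ofReal_rpow_of_nonneg measureReal_nonneg (by norm_num),
      ENNReal.ofReal_rpow_of_nonneg measureReal_nonneg (by norm_num),
      ← ENNReal.ofReal_mul (by positivity), ← ENNReal.ofReal_mul (by positivity),
      ← ENNReal.ofReal_mul (by positivity)]
    apply ENNReal.ofReal_le_ofReal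
    have h2 : ν.real (B ∩ {x | 2 ^ a * T ≤ |x i|}) ^ (1 / 2 : ℝ) ≤
        (2 * ν.real B * rexp (-(2 ^ a * T / (4 * A)))) ^ (1 / 2 : ℝ) :=
      rpow_le_rpow measureReal_nonneg h1 (by norm_num)
    rw [mul_rpow (by positivity) (by positivity), mul_rpow (by norm_num) (by positivity),
      ← exp_mul, ← sqrt_eq_rpow 2] at h2
    calc _ ≤ (2 ^ a * T) ^ 2 * _ := mul_le_mul_of_nonneg_left h2 (by positivity)
      _ = _ := by
        rw [show -(2 ^ a * T / (4 * A)) * (1 / 2) = -(2 * (1 / (16 * A)) * (2 ^ a * T)) by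
          field_simp; norm_num]
        ring
  refine (ENNReal.tsum_le_tsum key).trans ?_
  rw [ENNReal.tsum_mul_right, ← mul_assoc]
  gcongr
  refine (mul_le_mul_left (tsum_dyadic_sq_mul_exp_le (by positivity) hT) _).trans ?_
  rw [← ENNReal.ofReal_mul (by positivity)]
  apply ENNReal.ofReal_le_ofReal
  have h3 : √2 ≤ 1.43 := by rw [sqrt_le_left (by norm_num)]; norm_num
  calc _ ≤ 19 / (1 / (16 * A)) ^ 2 * rexp (-(1 / (16 * A) * T)) * 1.43 := by gcongr
    _ = 6955.52 * A ^ 2 * rexp (-(T / (16 * A))) := by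
      rw [one_div_mul_eq_div]; field_simp; norm_num
    _ ≤ _ := by gcongr; norm_num

end CoordinateTails

section HalfSpaces

variable {n : ℕ} {ν : Measure (EuclideanSpace ℝ (Fin n))} [IsProbabilityMeasure ν]

/-- The half-space `{2 ^ a * T ≤ ± x i}` indexed by `(i, ±, a)`. -/
def dyadicHalfSpace (T : ℝ) (ξ : Fin n × Bool × ℕ) : Set (EuclideanSpace ℝ (Fin n)) :=
  {x | 2 ^ ξ.2.2 * T ≤ (if ξ.2.1 then 1 else -1) * x ξ.1}

lemma measurableSet_dyadicHalfSpace (T : ℝ) (ξ : Fin n × Bool × ℕ) :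
    MeasurableSet (dyadicHalfSpace T ξ) :=
  measurableSet_le measurable_const (by fun_prop)

lemma convex_dyadicHalfSpace (T : ℝ) (ξ : Fin n × Bool × ℕ) :
    Convex ℝ (dyadicHalfSpace T ξ) :=
  convex_halfSpace_ge (IsLinearMap.mk (fun x y => by simp [mul_add])
    fun c x => by simp only [PiLp.smul_apply, smul_eq_mul]; ring) _

lemma dyadicHalfSpace_subset (T : ℝ) (i : Fin n) (e : Bool) (a : ℕ) :
    dyadicHalfSpace T (i, e, a) ⊆ {x | 2 ^ a * T ≤ |x i|} := fun x hx => by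
  refine le_trans (show 2 ^ a * T ≤ (if e then 1 else -1) * x i from hx) ?_
  cases e <;> simp [neg_le_abs, le_abs_self]

lemma LogConcaveMeasure.tsum_dyadicHalfSpace_le_aux (h : LogConcaveMeasure ν)
    (h2 : ∀ i, ∫⁻ x, ENNReal.ofReal (x i ^ 2) ∂ν ≤ 1) {p s T : ℝ} (hp : 1 ≤ p) (hs : 0 < s)
    (hT : 0 < T)
    (hmom : ∀ y, ∫⁻ x, ENNReal.ofReal (|⟪y, x⟫| ^ p) ∂ν ≤ ENNReal.ofReal ((s * ‖y‖) ^ p))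
    {B : Set (EuclideanSpace ℝ (Fin n))} (hB : MeasurableSet B) (hc : Convex ℝ B) {v : ℝ}
    (hv : 0 ≤ v) (hBv : ν.real B = rexp (-v)) :
    ∑' ξ : Fin n × Bool × ℕ, ENNReal.ofReal ((2 ^ ξ.2.2 * T) ^ 2) *
        ν (B ∩ dyadicHalfSpace T ξ) ^ (1 / 2 : ℝ) ≤
      ENNReal.ofReal (2 * 10 ^ 36 * ((1 + v / p) ^ 2 *
        (s ^ 2 + n * rexp (-(T / (16 * 10 ^ 16)))))) * ν B ^ (1 / 2 : ℝ) := by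
  classical
  have hB0 : 0 < ν.real B := hBv ▸ exp_pos _
  have hvp : 0 ≤ v / p := by positivity
  set α : Fin n → ℝ := fun i => (∫⁻ x in B, ENNReal.ofReal (x i ^ 2) ∂ν).toReal / ν.real B with hα
  have hα0 : ∀ i, 0 ≤ α i := fun i => by positivity
  have hαB : ∀ i, ∫⁻ x in B, ENNReal.ofReal (x i ^ 2) ∂ν = ENNReal.ofReal (α i * ν.real B) := by
    intro i
    rw [hα, div_mul_cancel₀ _ hB0.ne', ENNReal.ofReal_toReal]
    exact ((setLIntegral_le_lintegral _ _).trans (h2 i)).trans_lt ENNReal.one_lt_top |>.ne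
  set I := Finset.univ.filter fun i => 10 ^ 32 ≤ α i with hI
  set τ := (1 + v / p) * s with hτ
  have hIsum : ∑ i ∈ I, α i ≤ 2 * 10 ^ 30 * τ ^ 2 := by
    have h3 := h.setLIntegral_norm_sq_coordProj_le h2 hp hs hmom hB hc hv hBv I
    simp only [norm_sq_coordProj] at h3
    have e : ∀ x : EuclideanSpace ℝ (Fin n), ENNReal.ofReal (∑ i ∈ I, x i ^ 2) =
        ∑ i ∈ I, ENNReal.ofReal (x i ^ 2) := fun x =>
      ENNReal.ofReal_sum_of_nonneg fun i _ => sq_nonneg _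
    simp only [e] at h3
    rw [lintegral_finsetSum _ fun i _ => by fun_prop] at h3
    simp only [hαB] at h3
    rw [← ENNReal.ofReal_sum_of_nonneg fun i _ => mul_nonneg (hα0 i) hB0.le, ← Finset.sum_mul,
      ENNReal.ofReal_le_ofReal_iff (mul_nonneg (mul_nonneg (by norm_num)
        (add_nonneg (Nat.cast_nonneg _) (sq_nonneg _))) hB0.le)] at h3
    have h4 := le_of_mul_le_mul_right h3 hB0
    have h5 : I.card * (10 : ℝ) ^ 32 ≤ ∑ i ∈ I, α i := by
      rw [← nsmul_eq_mul]
      exact Finset.card_nsmul_le_sum _ _ _ fun i hi => (Finset.mem_filter.1 hi).2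
    linarith
  have hcoord : ∀ i, ∑' y : Bool × ℕ, ENNReal.ofReal ((2 ^ y.2 * T) ^ 2) *
        ν (B ∩ dyadicHalfSpace T (i, y)) ^ (1 / 2 : ℝ) ≤
      ENNReal.ofReal (14000 * ((if i ∈ I then α i else 0) +
        10 ^ 32 * rexp (-(T / (16 * 10 ^ 16))))) * ν B ^ (1 / 2 : ℝ) := by
    intro i
    have h6 : ∑' y : Bool × ℕ, ENNReal.ofReal ((2 ^ y.2 * T) ^ 2) *
          ν (B ∩ dyadicHalfSpace T (i, y)) ^ (1 / 2 : ℝ) ≤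
        2 * ∑' a : ℕ, ENNReal.ofReal ((2 ^ a * T) ^ 2) *
          ν (B ∩ {x | 2 ^ a * T ≤ |x i|}) ^ (1 / 2 : ℝ) := by
      rw [ENNReal.tsum_prod', tsum_bool, two_mul]
      gcongr <;> exact dyadicHalfSpace_subset T i _ _
    refine h6.trans ?_
    have h7 : ∑' a : ℕ, ENNReal.ofReal ((2 ^ a * T) ^ 2) *
          ν (B ∩ {x | 2 ^ a * T ≤ |x i|}) ^ (1 / 2 : ℝ) ≤
        ENNReal.ofReal (7000 * ((if i ∈ I then α i else 0) +
          10 ^ 32 * rexp (-(T / (16 * 10 ^ 16))))) * ν B ^ (1 / 2 : ℝ) := by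
      by_cases hiI : i ∈ I
      · have h8 : 10 ^ 32 ≤ α i := (Finset.mem_filter.1 hiI).2
        have h9 : 0 < α i := by linarith
        refine (h.tsum_sqrt_measure_inter_le hB hc (sqrt_pos.2 h9) hT
          (by rw [sq_sqrt h9.le, hαB])).trans ?_
        rw [sq_sqrt h9.le, if_pos hiI]
        refine mul_le_mul_left (ENNReal.ofReal_le_ofReal ?_) _
        have h10 : rexp (-(T / (16 * √(α i)))) ≤ 1 := exp_le_one_iff.2 (by
          rw [neg_nonpos]; positivity)
        have := exp_pos (-(T / (16 * 10 ^ 16)))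
        nlinarith
      · have h8 : α i ≤ 10 ^ 32 := by
          by_contra hcon
          exact hiI (Finset.mem_filter.2 ⟨Finset.mem_univ _, (not_le.1 hcon).le⟩)
        refine (h.tsum_sqrt_measure_inter_le hB hc (by norm_num : (0 : ℝ) < 10 ^ 16) hT
          (by rw [hαB]; gcongr; linarith)).trans ?_
        rw [if_neg hiI]
        refine mul_le_mul_left (ENNReal.ofReal_le_ofReal (le_of_eq ?_)) _
        ring
    refine (mul_le_mul_right h7 2).trans (le_of_eq ?_)
    rw [← mul_assoc]
    congr 1
    rw [← ENNReal.ofReal_ofNat, ← ENNReal.ofReal_mul (by norm_num), ← mul_assoc]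
    norm_num
  rw [ENNReal.tsum_prod', tsum_fintype]
  refine (Finset.sum_le_sum fun i _ => hcoord i).trans ?_
  rw [← Finset.sum_mul, ← ENNReal.ofReal_sum_of_nonneg fun i _ => by
    have := hα0 i
    split_ifs <;> positivity]
  gcongr
  rw [← Finset.mul_sum, Finset.sum_add_distrib, ← Finset.sum_filter, Finset.filter_mem_eq_inter,
    Finset.univ_inter, Finset.sum_const, Finset.card_univ, Fintype.card_fin, nsmul_eq_mul]
  have h11 : 1 ≤ (1 + v / p) ^ 2 := one_le_pow₀ (by linarith)
  have h12 : 0 ≤ n * rexp (-(T / (16 * 10 ^ 16))) := by positivity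
  have h13 : n * rexp (-(T / (16 * 10 ^ 16))) ≤
    (1 + v / p) ^ 2 * (n * rexp (-(T / (16 * 10 ^ 16)))) := le_mul_of_one_le_left h12 h11
  rw [hτ, mul_pow] at hIsum
  have h14 : 0 ≤ (1 + v / p) ^ 2 * s ^ 2 := by positivity
  linarith

lemma LogConcaveMeasure.tsum_dyadicHalfSpace_le (h : LogConcaveMeasure ν)
    (h2 : ∀ i, ∫⁻ x, ENNReal.ofReal (x i ^ 2) ∂ν ≤ 1) {p s T : ℝ} (hp : 1 ≤ p) (hs : 0 < s)
    (hT : 0 < T)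
    (hmom : ∀ y, ∫⁻ x, ENNReal.ofReal (|⟪y, x⟫| ^ p) ∂ν ≤ ENNReal.ofReal ((s * ‖y‖) ^ p))
    {q : ℕ} (hq : 1 ≤ q) (hqp : q ≤ 2 * p)
    {B : Set (EuclideanSpace ℝ (Fin n))} (hB : MeasurableSet B) (hc : Convex ℝ B) :
    ∑' ξ : Fin n × Bool × ℕ, ENNReal.ofReal ((2 ^ ξ.2.2 * T) ^ 2) *
        ν (B ∩ dyadicHalfSpace T ξ) ^ (1 / 2 : ℝ) ≤
      ENNReal.ofReal (2 * 10 ^ 38 * (s ^ 2 + n * rexp (-(T / (16 * 10 ^ 16))))) *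
        ν B ^ (1 / 2 - 1 / (2 * q) : ℝ) := by
  rcases (measureReal_nonneg (μ := ν) (s := B)).eq_or_lt with hB0 | hB0
  · have h0 : ν B = 0 := (measureReal_eq_zero_iff).1 hB0.symm
    have h1 : ∀ ξ, ν (B ∩ dyadicHalfSpace T ξ) = 0 := fun ξ =>
      measure_mono_null Set.inter_subset_left h0
    simp [h1]
  set v := -Real.log (ν.real B) with hv
  have hBv : ν.real B = rexp (-v) := by rw [hv, neg_neg, exp_log hB0]
  have hv0 : 0 ≤ v := by
    have := Real.log_nonpos hB0.le measureReal_le_one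
    linarith
  refine (h.tsum_dyadicHalfSpace_le_aux h2 hp hs hT hmom hB hc hv0 hBv).trans ?_
  have hq0 : (1 : ℝ) ≤ q := by exact_mod_cast hq
  have e1 : ν B ^ (1 / 2 - 1 / (2 * q) : ℝ) =
      ENNReal.ofReal (rexp (v / (2 * q))) * ν B ^ (1 / 2 : ℝ) := by
    rw [← ofReal_measureReal (μ := ν) (s := B), ENNReal.ofReal_rpow_of_pos hB0,
      ENNReal.ofReal_rpow_of_pos hB0, ← ENNReal.ofReal_mul (exp_pos _).le, hBv, ← exp_mul,
      ← exp_mul, ← exp_add]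
    congr 2
    field_simp
    ring
  rw [e1, ← mul_assoc (ENNReal.ofReal _), ← ENNReal.ofReal_mul (by positivity)]
  refine mul_le_mul_left (ENNReal.ofReal_le_ofReal ?_) _
  set z := v / (2 * q) with hz
  have hz0 : 0 ≤ z := by positivity
  have h3 : v / p ≤ 4 * z := by
    rw [hz, div_le_iff₀ (by linarith)]
    have : 4 * (v / (2 * q)) * p = v * (2 * p / q) := by field_simp; ring
    rw [this]
    refine le_mul_of_one_le_right hv0 ?_
    rw [one_le_div (by linarith)]; exact hqp
  have h4 : (1 + v / p) ^ 2 ≤ 64 * rexp z := by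
    have h5 := Real.quadratic_le_exp_of_nonneg hz0
    have h6 : 0 ≤ v / p := by positivity
    nlinarith
  calc 2 * 10 ^ 36 * ((1 + v / p) ^ 2 * (s ^ 2 + n * rexp (-(T / (16 * 10 ^ 16)))))
      ≤ 2 * 10 ^ 36 * (64 * rexp z * (s ^ 2 + n * rexp (-(T / (16 * 10 ^ 16))))) := by gcongr
    _ = 128 * 10 ^ 36 * (s ^ 2 + n * rexp (-(T / (16 * 10 ^ 16)))) * rexp z := by ring
    _ ≤ _ := by
      refine mul_le_mul_of_nonneg_right ?_ (exp_pos _).le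
      refine mul_le_mul_of_nonneg_right (by norm_num) (by positivity)

end HalfSpaces

section IndicatorSums

lemma lintegral_tsum_indicator_pow_le {Z ι : Type*} [MeasurableSpace Z] [Countable ι]
    {ν : Measure Z} {H : ι → Set Z} (hH : ∀ ξ, MeasurableSet (H ξ)) {w : ι → ℝ≥0∞}
    {𝒞 : Set Z → Prop} (h𝒞 : ∀ B, 𝒞 B → ∀ ξ, 𝒞 (B ∩ H ξ)) {Q : ℝ≥0∞} {q : ℕ} (hq : 1 ≤ q)
    (hQ : ∀ B, 𝒞 B → ∑' ξ, w ξ * ν (B ∩ H ξ) ^ (1 / 2 : ℝ) ≤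
      Q * ν B ^ (1 / 2 - 1 / (2 * q) : ℝ)) {j : ℕ} (hj : j ≤ q) :
    ∀ B, 𝒞 B → ∫⁻ x in B, (∑' ξ, (H ξ).indicator (fun _ => w ξ) x) ^ j ∂ν ≤
      Q ^ j * ν B ^ (1 - j / (2 * q) : ℝ) := by
  have hq0 : (1 : ℝ) ≤ q := by exact_mod_cast hq
  have hW : Measurable fun x => ∑' ξ, (H ξ).indicator (fun _ => w ξ) x :=
    .tsum fun ξ => measurable_const.indicator (hH ξ)
  induction j with
  | zero => intro B _; simp
  | succ j ih =>
    intro B hB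
    have hj0 : (j : ℝ) + 1 ≤ q := by exact_mod_cast hj
    have hexp : 0 ≤ (1 / 2 - j / (2 * q) : ℝ) := by
      rw [sub_nonneg, div_le_div_iff₀ (by linarith) (by norm_num)]; linarith
    have hexp' : 0 ≤ (1 / 2 - 1 / (2 * q) : ℝ) := by
      rw [sub_nonneg, div_le_div_iff₀ (by linarith) (by norm_num)]; linarith
    have e1 : ∫⁻ x in B, (∑' ξ, (H ξ).indicator (fun _ => w ξ) x) ^ (j + 1) ∂ν =
        ∑' ξ, w ξ * ∫⁻ x in B ∩ H ξ, (∑' ξ, (H ξ).indicator (fun _ => w ξ) x) ^ j ∂ν := by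
      simp_rw [pow_succ, ← ENNReal.tsum_mul_left]
      rw [lintegral_tsum]
      swap
      · exact fun ξ => ((hW.pow_const j).mul (measurable_const.indicator (hH ξ))).aemeasurable
      refine tsum_congr fun ξ => ?_
      rw [Set.inter_comm, ← Measure.restrict_restrict (hH ξ), ← lintegral_indicator (hH ξ),
        ← lintegral_const_mul _ ((hW.pow_const j).indicator (hH ξ))]
      refine lintegral_congr fun x => ?_
      by_cases hx : x ∈ H ξ <;> simp [hx, mul_comm]
    rw [e1]
    calc ∑' ξ, w ξ * ∫⁻ x in B ∩ H ξ, (∑' ξ, (H ξ).indicator (fun _ => w ξ) x) ^ j ∂ν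
        ≤ ∑' ξ, Q ^ j * ν B ^ (1 / 2 - j / (2 * q) : ℝ) *
            (w ξ * ν (B ∩ H ξ) ^ (1 / 2 : ℝ)) := by
          refine ENNReal.tsum_le_tsum fun ξ => ?_
          refine (mul_le_mul_right (ih (by omega) _ (h𝒞 B hB ξ)) _).trans ?_
          rw [show (1 - j / (2 * q) : ℝ) = (1 / 2 - j / (2 * q)) + 1 / 2 by ring,
            ENNReal.rpow_add_of_nonneg _ _ hexp (by norm_num)]
          calc w ξ * (Q ^ j * (ν (B ∩ H ξ) ^ (1 / 2 - j / (2 * q) : ℝ) *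
                ν (B ∩ H ξ) ^ (1 / 2 : ℝ)))
              ≤ w ξ * (Q ^ j * (ν B ^ (1 / 2 - j / (2 * q) : ℝ) *
                ν (B ∩ H ξ) ^ (1 / 2 : ℝ))) := by
                gcongr
                exact Set.inter_subset_left
            _ = _ := by ring
      _ ≤ Q ^ j * ν B ^ (1 / 2 - j / (2 * q) : ℝ) *
            (Q * ν B ^ (1 / 2 - 1 / (2 * q) : ℝ)) := by
          rw [ENNReal.tsum_mul_left]
          exact mul_le_mul_right (hQ B hB) _
      _ = _ := by
          rw [show (1 - ((j + 1 : ℕ) : ℝ) / (2 * q) : ℝ) =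
            (1 / 2 - j / (2 * q)) + (1 / 2 - 1 / (2 * q)) by push_cast; ring,
            ENNReal.rpow_add_of_nonneg _ _ hexp hexp', pow_succ]
          ring

end IndicatorSums

section LargeCoordinates

variable {n : ℕ}

lemma ofReal_sum_sq_le_tsum_dyadicHalfSpace {T : ℝ} (hT : 0 < T) {x : EuclideanSpace ℝ (Fin n)}
    {U : Finset (Fin n)} (hU : ∀ i ∈ U, T ≤ |x i|) :
    ENNReal.ofReal (∑ i ∈ U, x i ^ 2) ≤ 4 * ∑' ξ : Fin n × Bool × ℕ,
      (dyadicHalfSpace T ξ).indicator (fun _ => ENNReal.ofReal ((2 ^ ξ.2.2 * T) ^ 2)) x := by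
  rw [ENNReal.ofReal_sum_of_nonneg fun i _ => sq_nonneg _, ENNReal.tsum_prod', tsum_fintype,
    Finset.mul_sum]
  refine (Finset.sum_le_sum fun i hi => ?_).trans
    (Finset.sum_le_sum_of_subset (Finset.subset_univ U))
  obtain ⟨a, ha1, ha2⟩ := exists_nat_pow_near ((one_le_div hT).2 (hU i hi)) one_lt_two
  rw [le_div_iff₀ hT] at ha1
  rw [div_lt_iff₀ hT] at ha2
  set e : Bool := decide (0 ≤ x i) with he
  have hmem : x ∈ dyadicHalfSpace T (i, e, a) := by
    change 2 ^ a * T ≤ (if e then 1 else -1) * x i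
    refine ha1.trans (le_of_eq ?_)
    by_cases hx : 0 ≤ x i
    · simp [he, hx, abs_of_nonneg hx]
    · simp [he, hx, abs_of_neg (not_le.1 hx)]
  have h1 := ENNReal.le_tsum (f := fun y : Bool × ℕ => (dyadicHalfSpace T (i, y)).indicator
    (fun _ => ENNReal.ofReal ((2 ^ y.2 * T) ^ 2)) x) (e, a)
  rw [Set.indicator_of_mem hmem] at h1
  refine le_trans ?_ (mul_le_mul_right h1 4)
  rw [← ENNReal.ofReal_ofNat 4, ← ENNReal.ofReal_mul (by norm_num)]
  apply ENNReal.ofReal_le_ofReal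
  rw [← sq_abs (x i)]
  calc |x i| ^ 2 ≤ (2 ^ (a + 1) * T) ^ 2 := by gcongr
    _ = _ := by ring

/-- Large deviations of the sum of squares of the large coordinates. -/
lemma LogConcaveMeasure.exists_large_coords_le {ν : Measure (EuclideanSpace ℝ (Fin n))}
    [IsProbabilityMeasure ν] (h : LogConcaveMeasure ν)
    (h2 : ∀ i, ∫⁻ x, ENNReal.ofReal (x i ^ 2) ∂ν ≤ 1) {p s T : ℝ} (hp : 1 ≤ p) (hs : 0 < s)
    (hT : 0 < T)
    (hmom : ∀ y, ∫⁻ x, ENNReal.ofReal (|⟪y, x⟫| ^ p) ∂ν ≤ ENNReal.ofReal ((s * ‖y‖) ^ p))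
    {S : ℝ} (hS : 0 < S) (hSs : 10 ^ 40 * (s ^ 2 + n * rexp (-(T / (16 * 10 ^ 16)))) ≤ S) :
    ∃ V : Set (EuclideanSpace ℝ (Fin n)), MeasurableSet V ∧ ν.real V ≤ rexp (-p) ∧
      ∀ x U, (∀ i ∈ U, T ≤ |x i|) → S ≤ 2 * ∑ i ∈ U, x i ^ 2 → x ∈ V := by
  set W : EuclideanSpace ℝ (Fin n) → ℝ≥0∞ := fun x => ∑' ξ : Fin n × Bool × ℕ,
    (dyadicHalfSpace T ξ).indicator (fun _ => ENNReal.ofReal ((2 ^ ξ.2.2 * T) ^ 2)) x with hW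
  have hWm : Measurable W :=
    .tsum fun ξ => measurable_const.indicator (measurableSet_dyadicHalfSpace T ξ)
  refine ⟨{x | ENNReal.ofReal (S / 8) ≤ W x}, measurableSet_le measurable_const hWm, ?_, ?_⟩
  · obtain ⟨q, hpq, hqp⟩ : ∃ q : ℕ, p ≤ q ∧ q ≤ 2 * p :=
      ⟨⌈p⌉₊, Nat.le_ceil p, by
        have := (Nat.ceil_lt_add_one (by linarith : 0 ≤ p)).le
        linarith⟩
    have hq : 1 ≤ q := by exact_mod_cast hp.trans hpq
    set Q : ℝ := 2 * 10 ^ 38 * (s ^ 2 + n * rexp (-(T / (16 * 10 ^ 16)))) with hQ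
    have hQ0 : 0 ≤ Q := by positivity
    have h3 := lintegral_tsum_indicator_pow_le (ν := ν)
      (measurableSet_dyadicHalfSpace (n := n) T)
      (w := fun ξ => ENNReal.ofReal ((2 ^ ξ.2.2 * T) ^ 2))
      (𝒞 := fun B => MeasurableSet B ∧ Convex ℝ B)
      (fun B hB ξ => ⟨hB.1.inter (measurableSet_dyadicHalfSpace T ξ),
        hB.2.inter (convex_dyadicHalfSpace T ξ)⟩) hq
      (fun B hB => h.tsum_dyadicHalfSpace_le h2 hp hs hT hmom hq hqp hB.1 hB.2) le_rfl
      Set.univ ⟨MeasurableSet.univ, convex_univ⟩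
    rw [Measure.restrict_univ, measure_univ, ENNReal.one_rpow, mul_one] at h3
    change ∫⁻ x, W x ^ q ∂ν ≤ ENNReal.ofReal Q ^ q at h3
    have h4 := (mul_meas_ge_le_lintegral (μ := ν) (hWm.pow_const q)
      (ENNReal.ofReal (S / 8) ^ q)).trans h3
    have h5 : {x | ENNReal.ofReal (S / 8) ≤ W x} ⊆
        {x | ENNReal.ofReal (S / 8) ^ q ≤ W x ^ q} := fun x hx => by
      have hx' : ENNReal.ofReal (S / 8) ≤ W x := hx
      exact pow_le_pow_left₀ zero_le hx' q
    replace h4 := (mul_le_mul_right (measure_mono (μ := ν) h5) _).trans h4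
    rw [← ofReal_measureReal, ← ENNReal.ofReal_pow (by positivity), ← ENNReal.ofReal_pow hQ0,
      ← ENNReal.ofReal_mul (by positivity), ENNReal.ofReal_le_ofReal_iff (by positivity)] at h4
    have h6 : Q ≤ S / 8 * rexp (-1) := by
      have := Real.exp_neg_one_gt_d9
      rw [hQ]
      nlinarith
    have h7 : Q ^ q ≤ (S / 8) ^ q * rexp (-q) := by
      calc Q ^ q ≤ (S / 8 * rexp (-1)) ^ q := by gcongr
        _ = _ := by rw [mul_pow, ← exp_nat_mul]; ring_nf
    refine (le_of_mul_le_mul_left (h4.trans h7) (by positivity)).trans ?_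
    gcongr
  · intro x U hU hSU
    have h8 := ofReal_sum_sq_le_tsum_dyadicHalfSpace hT hU
    have h9 : ENNReal.ofReal (S / 2) ≤ 4 * W x :=
      (ENNReal.ofReal_le_ofReal (by linarith)).trans h8
    have h10 : ENNReal.ofReal (S / 2) = 4 * ENNReal.ofReal (S / 8) := by
      rw [← ENNReal.ofReal_ofNat, ← ENNReal.ofReal_mul (by norm_num)]
      ring_nf
    rw [h10] at h9
    exact (ENNReal.mul_le_mul_iff_right (by norm_num) (by norm_num)).1 h9

end LargeCoordinates

section OrderStatistics

variable {n : ℕ}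

lemma exists_card_eq_of_le_orderStat {x : Fin n → ℝ} {m : ℕ} (hm : m ≤ n) {t : ℝ}
    (h : t ≤ orderStat x m) : ∃ I : Finset (Fin n), I.card = m ∧ ∀ i ∈ I, t ≤ |x i| := by
  obtain ⟨J, -, hJ⟩ := Finset.exists_subset_card_eq
    (show m ≤ (Finset.univ : Finset (Fin n)).card by simpa using hm)
  have : Nonempty {I : Finset (Fin n) // I.card = m} := ⟨⟨J, hJ⟩⟩
  obtain ⟨I, hI⟩ := exists_eq_ciSup_of_finite
    (f := fun I : {I : Finset (Fin n) // I.card = m} => ⨅ i : I.1, |x i|)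
  refine ⟨I.1, I.2, fun i hi => ?_⟩
  rw [orderStat, ← hI] at h
  exact h.trans (ciInf_le (f := fun i : I.1 => |x i|) (Set.finite_range _).bddBelow ⟨i, hi⟩)

lemma exists_finset_le_sum_sq {x : Fin n → ℝ} {l : ℕ → ℕ} {t : ℕ → ℝ} {T : ℝ} (hl0 : l 0 = 0)
    {k : ℕ} (hl : ∀ j < k, l j < l (j + 1)) (ht : ∀ r, 1 ≤ r → r ≤ k → 0 ≤ t r)
    (hT : ∀ r, 1 ≤ r → r ≤ k → T ≤ t r)
    (hI : ∀ j, 1 ≤ j → j ≤ k → ∃ I : Finset (Fin n), I.card = l j ∧ ∀ i ∈ I, t j ≤ |x i|) :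
    ∃ U : Finset (Fin n), U.card = l k ∧ (∀ i ∈ U, T ≤ |x i|) ∧
      ∑ j ∈ Finset.Icc 1 k, t j ^ 2 * ((l j : ℝ) - (l (j - 1) : ℝ)) ≤ ∑ i ∈ U, x i ^ 2 := by
  induction k with
  | zero => exact ⟨∅, by simp [hl0], by simp, by simp⟩
  | succ k ih =>
    obtain ⟨U, hU1, hU2, hU3⟩ := ih (fun j hj => hl j (by omega))
      (fun r h1 h2 => ht r h1 (by omega)) (fun r h1 h2 => hT r h1 (by omega))
      (fun j h1 h2 => hI j h1 (by omega))
    obtain ⟨I, hI1, hI2⟩ := hI (k + 1) (by omega) le_rfl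
    obtain ⟨D, hD1, hD2⟩ := Finset.exists_subset_card_eq
      (show l (k + 1) - l k ≤ (I \ U).card by
        have := Finset.le_card_sdiff U I
        omega)
    have hlk := hl k (by omega)
    have hdisj : Disjoint U D :=
      Finset.disjoint_left.2 fun i hi hiD => (Finset.mem_sdiff.1 (hD1 hiD)).2 hi
    have hDI : ∀ i ∈ D, t (k + 1) ≤ |x i| := fun i hi => hI2 i (Finset.mem_sdiff.1 (hD1 hi)).1
    refine ⟨U ∪ D, by rw [Finset.card_union_of_disjoint hdisj]; omega, ?_, ?_⟩
    · intro i hi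
      rcases Finset.mem_union.1 hi with hi | hi
      · exact hU2 i hi
      · exact (hT (k + 1) (by omega) le_rfl).trans (hDI i hi)
    · rw [Finset.sum_Icc_succ_top (by omega), Finset.sum_union hdisj]
      refine add_le_add hU3 ?_
      have h1 : D.card • (t (k + 1) ^ 2) ≤ ∑ i ∈ D, x i ^ 2 :=
        Finset.card_nsmul_le_sum _ _ _ fun i hi => by
          rw [← sq_abs (x i)]
          exact pow_le_pow_left₀ (ht _ (by omega) le_rfl) (hDI i hi) 2
      rw [hD2, nsmul_eq_mul, Nat.cast_sub hlk.le] at h1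
      rw [Nat.add_sub_cancel]
      linarith

end OrderStatistics

section Isotropic

variable {n : ℕ} {μ : Measure Ω}
  {X : Ω → EuclideanSpace ℝ (Fin n)}

lemma IsIsotropic.lintegral_sq_eq_one (hX : Measurable X) (h : IsIsotropic μ X) (i : Fin n) :
    ∫⁻ x, ENNReal.ofReal (x i ^ 2) ∂(μ.map X) = 1 := by
  have h1 := h.2 i i
  rw [if_pos rfl] at h1
  have h2 : Integrable (fun ω => X ω i * X ω i) μ := by
    by_contra hcon
    rw [integral_undef hcon] at h1
    exact zero_ne_one h1
  rw [lintegral_map (by fun_prop) hX]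
  simp only [sq]
  rw [← ofReal_integral_eq_lintegral_ofReal h2 (ae_of_all _ fun ω => mul_self_nonneg _), h1,
    ENNReal.ofReal_one]

variable [IsProbabilityMeasure μ]

lemma LogConcaveMeasure.lintegral_norm_pow_lt_top {ν : Measure (EuclideanSpace ℝ (Fin n))}
    [IsProbabilityMeasure ν] (h : LogConcaveMeasure ν)
    (h2 : ∀ i, ∫⁻ x, ENNReal.ofReal (x i ^ 2) ∂ν ≤ 1) (k : ℕ) :
    ∫⁻ x, ENNReal.ofReal (‖x‖ ^ k) ∂ν < ∞ := by
  set r : ℝ := 2 * √(n + 1) with hr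
  have hr0 : 0 < r := by positivity
  have h3 := rpow_mul_measureReal_le_of_lintegral (κ := ν)
    (coordProj (Finset.univ : Finset (Fin n))).continuous.measurable.norm two_pos hr0
    (Nat.cast_nonneg _) (lintegral_norm_sq_coordProj_le h2 Finset.univ)
  have h4 : ν.real {x | r ≤ ‖coordProj Finset.univ x‖} ≤ 1 / 4 * ν.real Set.univ := by
    rw [rpow_two, hr, mul_pow, sq_sqrt (by positivity), Finset.card_univ, Fintype.card_fin] at h3
    rw [probReal_univ]
    nlinarith [measureReal_nonneg (μ := ν) (s := {x | r ≤ ‖coordProj Finset.univ x‖})]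
  have h5 := lintegral_norm_pow_le (coordProj Finset.univ) hr0 (b := 1 / 2) (T := 2) le_rfl
    (by rw [probReal_univ (μ := ν)]; norm_num) (fun t _ => by
      refine (h.borell' _ hr0 h4 (t * r)).trans (le_of_eq ?_)
      rw [probReal_univ (μ := ν), mul_one]
      congr 3
      field_simp) k
  have e : ∀ x : EuclideanSpace ℝ (Fin n), coordProj Finset.univ x = x := fun x => by
    ext i
    simp [coordProj_apply]
  simp only [e] at h5
  exact h5.trans_lt ENNReal.ofReal_lt_top

lemma LogConcaveMeasure.integrable_norm_rpow {ν : Measure (EuclideanSpace ℝ (Fin n))}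
    [IsProbabilityMeasure ν] (h : LogConcaveMeasure ν)
    (h2 : ∀ i, ∫⁻ x, ENNReal.ofReal (x i ^ 2) ∂ν ≤ 1) {p : ℝ} (hp : 0 ≤ p) :
    Integrable (fun x => ‖x‖ ^ p) ν := by
  have h1 : Integrable (fun x => ‖x‖ ^ ⌈p⌉₊) ν :=
    (lintegral_ofReal_ne_top_iff_integrable (by fun_prop) (ae_of_all _ fun x => by positivity)).1
      (h.lintegral_norm_pow_lt_top h2 ⌈p⌉₊).ne
  refine ((integrable_const (1 : ℝ)).add h1).mono'
    (measurable_norm.pow_const p).aestronglyMeasurable (ae_of_all _ fun x => ?_)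
  rw [Real.norm_eq_abs, abs_of_nonneg (by positivity), Pi.add_apply]
  rcases le_total ‖x‖ 1 with hx | hx
  · have := rpow_le_one (norm_nonneg x) hx hp
    have : 0 ≤ ‖x‖ ^ ⌈p⌉₊ := by positivity
    linarith
  · have := rpow_le_rpow_of_exponent_le hx (Nat.le_ceil p)
    rw [rpow_natCast] at this
    linarith

lemma lintegral_inner_rpow_le_of_sigmaX_le (hX : Measurable X)
    (hLC : LogConcaveMeasure (μ.map X))
    (h2 : ∀ i, ∫⁻ x, ENNReal.ofReal (x i ^ 2) ∂(μ.map X) ≤ 1) {p s : ℝ} (hp : 1 ≤ p)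
    (h : sigmaX μ X p ≤ s) (y : EuclideanSpace ℝ (Fin n)) :
    ∫⁻ x, ENNReal.ofReal (|⟪y, x⟫| ^ p) ∂(μ.map X) ≤ ENNReal.ofReal ((s * ‖y‖) ^ p) := by
  have hp0 : 0 < p := by linarith
  rcases eq_or_ne y 0 with rfl | hy
  · simp [hp0.ne']
  have hprob : IsProbabilityMeasure (μ.map X) := Measure.isProbabilityMeasure_map hX.aemeasurable
  have hn : Integrable (fun ω => ‖X ω‖ ^ p) μ :=
    (hLC.integrable_norm_rpow h2 hp0.le).comp_measurable hX
  have hle : ∀ z : EuclideanSpace ℝ (Fin n), ∀ ω, |⟪z, X ω⟫| ^ p ≤ ‖z‖ ^ p * ‖X ω‖ ^ p := by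
    intro z ω
    rw [← mul_rpow (norm_nonneg _) (norm_nonneg _)]
    exact rpow_le_rpow (abs_nonneg _) (abs_real_inner_le_norm _ _) hp0.le
  have hint : ∀ z : EuclideanSpace ℝ (Fin n), Integrable (fun ω => |⟪z, X ω⟫| ^ p) μ := by
    intro z
    have hm : Measurable fun ω => |⟪z, X ω⟫| ^ p :=
      (show Measurable fun x : EuclideanSpace ℝ (Fin n) => |⟪z, x⟫| ^ p by fun_prop).comp hX
    refine (hn.const_mul (‖z‖ ^ p)).mono' hm.aestronglyMeasurable (ae_of_all _ fun ω => ?_)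
    rw [Real.norm_eq_abs, abs_of_nonneg (by positivity)]
    exact hle z ω
  have hbdd : BddAbove (Set.range fun t : {t : EuclideanSpace ℝ (Fin n) // ‖t‖ = 1} =>
      (∫ ω, |⟪t.1, X ω⟫| ^ p ∂μ) ^ (1 / p)) := by
    refine ⟨(∫ ω, ‖X ω‖ ^ p ∂μ) ^ (1 / p), ?_⟩
    rintro _ ⟨t, rfl⟩
    refine rpow_le_rpow (integral_nonneg fun ω => by positivity)
      (integral_mono (hint t.1) hn fun ω => ?_) (by positivity)
    simpa [t.2] using hle t.1 ω
  have hy0 : 0 < ‖y‖ := norm_pos_iff.2 hy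
  have hunit : ‖(‖y‖⁻¹ • y)‖ = 1 := by
    rw [norm_smul, norm_inv, norm_norm, inv_mul_cancel₀ hy0.ne']
  have h3 := (le_ciSup hbdd ⟨‖y‖⁻¹ • y, hunit⟩).trans h
  have h4 : (0 : ℝ) ≤ ∫ ω, |⟪‖y‖⁻¹ • y, X ω⟫| ^ p ∂μ := integral_nonneg fun ω => by positivity
  have h5 : ∫ ω, |⟪‖y‖⁻¹ • y, X ω⟫| ^ p ∂μ ≤ s ^ p := by
    have := rpow_le_rpow (by positivity) h3 hp0.le
    rwa [one_div, rpow_inv_rpow h4 hp0.ne'] at this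
  have hs : 0 ≤ s := le_trans (by positivity) h3
  have h6 : ∫ ω, |⟪y, X ω⟫| ^ p ∂μ = ‖y‖ ^ p * ∫ ω, |⟪‖y‖⁻¹ • y, X ω⟫| ^ p ∂μ := by
    rw [← integral_const_mul]
    congr 1
    ext ω
    rw [real_inner_smul_left, abs_mul, abs_inv, abs_norm, mul_rpow (by positivity) (abs_nonneg _),
      ← mul_assoc, ← mul_rpow hy0.le (by positivity), mul_inv_cancel₀ hy0.ne', one_rpow, one_mul]
  rw [lintegral_map (by fun_prop) hX,
    ← ofReal_integral_eq_lintegral_ofReal (hint y) (ae_of_all _ fun ω => by positivity), h6,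
    mul_rpow hs hy0.le, mul_comm (s ^ p)]
  gcongr

lemma sigmaXInv_zero_le (hX : Measurable X) (hLC : LogConcaveMeasure (μ.map X))
    (hiso : IsIsotropic μ X) : sigmaXInv μ X 0 ≤ 0 := by
  have h2 := hiso.lintegral_sq_eq_one hX
  rcases Nat.eq_zero_or_pos n with rfl | hn
  · refine (Real.sSup_of_not_bddAbove ?_).le
    rintro ⟨M, hM⟩
    have : IsEmpty {t : EuclideanSpace ℝ (Fin 0) // ‖t‖ = 1} :=
      ⟨fun t => by simpa [Subsingleton.elim t.1 0] using t.2⟩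
    have h3 := hM (a := max 1 (M + 1)) ⟨le_max_left _ _, by
      rw [sigmaX, Real.iSup_of_isEmpty]⟩
    linarith [le_max_right 1 (M + 1)]
  · refine Real.sSup_nonpos fun p hp => ?_
    exfalso
    obtain ⟨hp1, hp2⟩ := hp
    have hp0 : p ≠ 0 := by linarith
    set i : Fin n := ⟨0, hn⟩
    have h3 := lintegral_inner_rpow_le_of_sigmaX_le hX hLC (fun i => (h2 i).le) hp1 hp2
      (EuclideanSpace.single i 1)
    rw [zero_mul, zero_rpow hp0, ENNReal.ofReal_zero, nonpos_iff_eq_zero,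
      lintegral_eq_zero_iff (by fun_prop)] at h3
    have h4 := h2 i
    rw [lintegral_congr_ae (g := fun _ => 0), lintegral_zero] at h4
    · exact zero_ne_one h4
    · filter_upwards [h3] with x hx
      have h5 : |x i| ^ p ≤ 0 := by
        simpa [EuclideanSpace.inner_single_left] using hx
      have h6 : x i = 0 := by
        by_contra hcon
        have := abs_pos.2 hcon
        have : 0 < |x i| ^ p := by positivity
        linarith
      simp [h6]

end Isotropic

lemma exists_threshold {N S : ℝ} (hN : 0 < N) (hS : 0 < S) :
    ∃ T : ℝ, 1 ≤ T ∧ N * rexp (-(T / (16 * 10 ^ 16))) ≤ 3 * (S / (10 ^ 21) ^ 2) ∧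
      (T = 10 ^ 21 * Real.log ((10 ^ 21) ^ 2 * N / S) ∨ T = 1 ∧ N ≤ S / 2) := by
  set z : ℝ := (10 ^ 21) ^ 2 * N / S with hz
  have hz0 : 0 < z := by positivity
  have hNz : N = z * (S / (10 ^ 21) ^ 2) := by rw [hz]; field_simp
  rcases le_or_gt 1 (10 ^ 21 * Real.log z) with hL | hL
  · refine ⟨_, hL, ?_, Or.inl rfl⟩
    have hlog : 0 ≤ Real.log z := by linarith
    have h1 : rexp (-(10 ^ 21 * Real.log z / (16 * 10 ^ 16))) ≤ z⁻¹ := by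
      rw [← exp_log (inv_pos.2 hz0), Real.log_inv]
      apply exp_le_exp.2
      linarith
    calc N * rexp (-(10 ^ 21 * Real.log z / (16 * 10 ^ 16))) ≤ N * z⁻¹ := by gcongr
      _ = S / (10 ^ 21) ^ 2 := by rw [hNz]; field_simp
      _ ≤ _ := by linarith [show 0 < S / (10 ^ 21) ^ 2 by positivity]
  · have hz3 : z ≤ 3 := by
      have h1 : Real.log z ≤ 1 := by linarith
      rw [Real.log_le_iff_le_exp hz0] at h1
      linarith [Real.exp_one_lt_d9]
    have hN3 : N ≤ 3 * (S / (10 ^ 21) ^ 2) := by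
      rw [hNz]
      gcongr
    refine ⟨1, le_rfl, ?_, Or.inr ⟨rfl, hN3.trans (by linarith)⟩⟩
    exact (mul_le_of_le_one_right hN.le (exp_le_one_iff.2 (by norm_num))).trans hN3

/-- **Theorem 4 (joint distribution of order statistics).** There is a universal constant
`C > 0` such that for every isotropic log-concave random vector `X` in `ℝⁿ`, all integers
`0 = l 0 < l 1 < … < l k ≤ n` and all `t 1, …, t k ≥ 0` satisfying
`t r ≥ C·log(C²·n / ∑_{j=1}^k (t j)²·(l j − l (j−1)))` for each `1 ≤ r ≤ k`, one has
`P(X*_{l 1} ≥ t 1, …, X*_{l k} ≥ t k) ≤ exp(−σ_X⁻¹((1/C)·√(∑_{j=1}^k (t j)²·(l j − l (j−1)))))`. -/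
theorem joint_order_statistics :
    ∃ C : ℝ, 0 < C ∧
      ∀ (Ω : Type) (_ : MeasurableSpace Ω) (μ : Measure Ω), IsProbabilityMeasure μ →
      ∀ (n : ℕ) (X : Ω → EuclideanSpace ℝ (Fin n)), Measurable X →
      IsLogConcave μ X → IsIsotropic μ X →
      ∀ (k : ℕ) (l : ℕ → ℕ) (t : ℕ → ℝ),
        l 0 = 0 → (∀ j < k, l j < l (j + 1)) → l k ≤ n →
        (∀ r, 1 ≤ r → r ≤ k → 0 ≤ t r) →
        (∀ r, 1 ≤ r → r ≤ k →
          C * Real.log (C ^ 2 * (n : ℝ) /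
            ∑ j ∈ Finset.Icc 1 k, (t j) ^ 2 * ((l j : ℝ) - (l (j - 1) : ℝ))) ≤ t r) →
        (μ {ω | ∀ j, 1 ≤ j → j ≤ k → t j ≤ orderStat (fun i => X ω i) (l j)}).toReal ≤
          Real.exp (-(sigmaXInv μ X ((1 / C) *
            Real.sqrt (∑ j ∈ Finset.Icc 1 k, (t j) ^ 2 * ((l j : ℝ) - (l (j - 1) : ℝ)))))) := by
  refine ⟨10 ^ 21, by norm_num, ?_⟩
  intro Ω _ μ _ n X hX hlc hiso k l t hl0 hl hlk ht htL
  have hLC := hlc.logConcaveMeasure_map hX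
  have hprob : IsProbabilityMeasure (μ.map X) := Measure.isProbabilityMeasure_map hX.aemeasurable
  have h2 : ∀ i, ∫⁻ x, ENNReal.ofReal (x i ^ 2) ∂(μ.map X) ≤ 1 := fun i =>
    (hiso.lintegral_sq_eq_one hX i).le
  change μ.real _ ≤ _
  set A := {ω | ∀ j, 1 ≤ j → j ≤ k → t j ≤ orderStat (fun i => X ω i) (l j)} with hA
  have hS0 : 0 ≤ ∑ j ∈ Finset.Icc 1 k, (t j) ^ 2 * ((l j : ℝ) - (l (j - 1) : ℝ)) := by
    refine Finset.sum_nonneg fun j hj => mul_nonneg (sq_nonneg _) ?_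
    obtain ⟨hj1, hj2⟩ := Finset.mem_Icc.1 hj
    have := hl (j - 1) (by omega)
    rw [Nat.sub_add_cancel hj1] at this
    exact sub_nonneg.2 (by exact_mod_cast this.le)
  set S := ∑ j ∈ Finset.Icc 1 k, (t j) ^ 2 * ((l j : ℝ) - (l (j - 1) : ℝ)) with hSdef
  rcases hS0.eq_or_lt with hS | hS
  · rw [← hS, sqrt_zero, mul_zero]
    exact measureReal_le_one.trans (one_le_exp (by
      linarith [sigmaXInv_zero_le hX hLC hiso]))
  have hlpos : ∀ j, 1 ≤ j → j ≤ k → 1 ≤ l j := fun j hj1 hj2 => by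
    have := hl (j - 1) (by omega)
    rw [Nat.sub_add_cancel hj1] at this
    omega
  have hlmono : ∀ j, j ≤ k → l j ≤ n := fun j hj => by
    induction hj using Nat.decreasingInduction with
    | self => exact hlk
    | of_succ m hm ih => exact (hl m hm).le.trans ih
  have hk : 1 ≤ k := by
    by_contra hcon
    obtain rfl : k = 0 := by omega
    simp [hSdef] at hS
  have hn : (0 : ℝ) < n := by
    exact_mod_cast (hlpos k hk le_rfl).trans hlk
  obtain ⟨T, hT1, hTexp, hT⟩ := exists_threshold hn hS
  have hevent : ∀ ω ∈ A, ∃ U : Finset (Fin n), (∀ i ∈ U, T ≤ |X ω i|) ∧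
      S ≤ 2 * ∑ i ∈ U, X ω i ^ 2 := by
    intro ω hω
    have hI : ∀ j, 1 ≤ j → j ≤ k → ∃ I : Finset (Fin n), I.card = l j ∧ ∀ i ∈ I, t j ≤ |X ω i| :=
      fun j hj1 hj2 => exists_card_eq_of_le_orderStat (hlmono j hj2) (hω j hj1 hj2)
    rcases hT with hT | ⟨rfl, hnS⟩
    · obtain ⟨U, -, hU2, hU3⟩ := exists_finset_le_sum_sq (x := fun i => X ω i) hl0 hl ht
        (fun r hr1 hr2 => hT.trans_le (htL r hr1 hr2)) hI
      exact ⟨U, hU2, by linarith⟩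
    · obtain ⟨U, -, -, hU3⟩ := exists_finset_le_sum_sq (x := fun i => X ω i) hl0 hl ht ht hI
      refine ⟨U.filter fun i => 1 ≤ |X ω i|, fun i hi => (Finset.mem_filter.1 hi).2, ?_⟩
      have h3 : ∑ i ∈ U.filter (fun i => ¬ 1 ≤ |X ω i|), X ω i ^ 2 ≤ n := by
        calc ∑ i ∈ U.filter (fun i => ¬ 1 ≤ |X ω i|), X ω i ^ 2
            ≤ ∑ i ∈ U.filter (fun i => ¬ 1 ≤ |X ω i|), 1 :=
              Finset.sum_le_sum fun i hi => by
                rw [← sq_abs]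
                exact pow_le_one₀ (abs_nonneg _) (not_le.1 (Finset.mem_filter.1 hi).2).le
          _ ≤ ∑ i : Fin n, (1 : ℝ) :=
              Finset.sum_le_sum_of_subset_of_nonneg (Finset.subset_univ _) fun _ _ _ => zero_le_one
          _ = n := by simp
      have h4 := Finset.sum_filter_add_sum_filter_not U (fun i => 1 ≤ |X ω i|)
        (fun i => X ω i ^ 2)
      linarith
  have hbound : ∀ p, 1 ≤ p → sigmaX μ X p ≤ 1 / 10 ^ 21 * √S → μ.real A ≤ rexp (-p) := by
    intro p hp hσ
    obtain ⟨V, hV, hVp, hVmem⟩ := hLC.exists_large_coords_le h2 hp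
      (by positivity : 0 < 1 / 10 ^ 21 * √S) (by linarith : 0 < T)
      (lintegral_inner_rpow_le_of_sigmaX_le hX hLC h2 hp hσ) hS (by
        rw [mul_pow, sq_sqrt hS.le]
        linarith)
    rw [map_measureReal_apply hX hV] at hVp
    refine (measureReal_mono fun ω hω => ?_).trans hVp
    obtain ⟨U, hU1, hU2⟩ := hevent ω hω
    exact hVmem (X ω) U hU1 hU2
  rcases (measureReal_nonneg (μ := μ) (s := A)).eq_or_lt with hA0 | hA0
  · rw [← hA0]
    exact (exp_pos _).le
  have hlogA : Real.log (μ.real A) ≤ 0 := Real.log_nonpos hA0.le measureReal_le_one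
  have hsup : sigmaXInv μ X (1 / 10 ^ 21 * √S) ≤ -Real.log (μ.real A) := by
    refine Real.sSup_le (fun p hp => ?_) (by linarith)
    have := (Real.log_le_iff_le_exp hA0).2 (hbound p hp.1 hp.2)
    linarith
  rw [← Real.log_le_iff_le_exp hA0]
  linarith

end
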